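/- arXiv:2012.05666 — 4 statements merged into one kernel-verified Lean document; each statement's English description precedes it below -/
import Mathlib

section
/- Let α, m > 0 be real numbers and l > −1/α. The function x ↦ E_{α,m,l}(−x) is completely monotone on (0,∞) if and only if α ≤ 1 and l ≥ m − 1/α. -/
/-- The Kilbas-Saigo function `E_{α,m,l}(x)` for real argument. -/
noncomputable def kilbasSaigo (α m l : ℝ) (x : ℝ) : ℝ :=
  ∑' n : ℕ, (∏ k ∈ Finset.range n,
    Real.Gamma (1 + α * (k * m + l)) / Real.Gamma (1 + α * (k * m + l + 1))) * x ^ n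

/-- A function `f` is completely monotone on `(0,∞)`. -/
def CompletelyMonotoneOn (f : ℝ → ℝ) : Prop :=
  (∀ n : ℕ, DifferentiableOn ℝ (iteratedDerivWithin n f (Set.Ioi 0)) (Set.Ioi 0)) ∧
  ∀ n : ℕ, ∀ x ∈ Set.Ioi (0 : ℝ), 0 ≤ (-1) ^ n * iteratedDerivWithin n f (Set.Ioi 0) x

open Filter Topology MeasureTheory

/-- The alternating exponential generating function of a sequence. -/
noncomputable def KS.L (M : ℕ → ℝ) (x : ℝ) : ℝ := ∑' n : ℕ, (-x) ^ n / n.factorial * M n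

/-- Nonnegative sequences whose exponential generating function is entire. -/
def KS.Ent (M : ℕ → ℝ) : Prop :=
  (∀ n, 0 ≤ M n) ∧ ∀ R : ℝ, 0 < R → Summable (fun n : ℕ => R ^ n / n.factorial * M n)

namespace KS

lemma ofReal_integrand (p r t : ℝ) (ht : t ∈ Set.Ioc (0:ℝ) 1) :
    (t : ℂ) ^ ((p : ℂ) - 1) * (1 - (t : ℂ)) ^ ((r : ℂ) - 1)
      = ((t ^ (p - 1) * (1 - t) ^ (r - 1) : ℝ) : ℂ) := by
  rw [Complex.ofReal_mul, Complex.ofReal_cpow ht.1.le, Complex.ofReal_cpow (by linarith [ht.2])]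
  push_cast
  rfl

lemma beta_integrable {p r : ℝ} (hp : 0 < p) (hr : 0 < r) :
    IntervalIntegrable (fun t : ℝ => t ^ (p - 1) * (1 - t) ^ (r - 1)) volume 0 1 := by
  have h := Complex.betaIntegral_convergent (u := p) (v := r) (by simpa) (by simpa)
  rw [intervalIntegrable_iff_integrableOn_Ioc_of_le zero_le_one] at h ⊢
  have h2 := h.re
  refine IntegrableOn.congr_fun h2 (fun t ht => ?_) measurableSet_Ioc
  rw [ofReal_integrand p r t ht]
  simp

lemma beta_integral {p r : ℝ} (hp : 0 < p) (hr : 0 < r) :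
    ∫ t in (0:ℝ)..1, t ^ (p - 1) * (1 - t) ^ (r - 1)
      = Real.Gamma p * Real.Gamma r / Real.Gamma (p + r) := by
  have h := Complex.betaIntegral_eq_Gamma_mul_div p r (by simpa) (by simpa)
  have h1 : Complex.betaIntegral p r
      = ((∫ t in (0:ℝ)..1, t ^ (p - 1) * (1 - t) ^ (r - 1) : ℝ) : ℂ) := by
    rw [Complex.betaIntegral, ← intervalIntegral.integral_ofReal]
    refine intervalIntegral.integral_congr_ae (Eventually.of_forall fun t ht => ?_)
    rw [Set.uIoc_of_le zero_le_one] at ht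
    exact ofReal_integrand p r t ht
  rw [h1, ← Complex.ofReal_add, Complex.Gamma_ofReal, Complex.Gamma_ofReal,
    Complex.Gamma_ofReal] at h
  exact_mod_cast h

lemma swap (c : ℕ → ℝ) (hc : Summable fun n => |c n|) {p r a : ℝ} (hp : 0 < p) (hr : 0 < r)
    (ha : 0 ≤ a) :
    HasSum (fun n : ℕ => c n * (Real.Gamma (p + a * n) * Real.Gamma r / Real.Gamma (p + a * n + r)))
      (∫ t in (0:ℝ)..1, (∑' n : ℕ, c n * (t ^ a) ^ n) * (t ^ (p - 1) * (1 - t) ^ (r - 1))) := by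
  have key : ∀ n : ℕ, c n * (Real.Gamma (p + a * n) * Real.Gamma r / Real.Gamma (p + a * n + r))
      = ∫ t in (0:ℝ)..1, (c n * (t ^ a) ^ n) * (t ^ (p - 1) * (1 - t) ^ (r - 1)) := by
    intro n
    rw [← beta_integral (by positivity) hr, ← intervalIntegral.integral_const_mul]
    refine intervalIntegral.integral_congr_ae (Eventually.of_forall fun t ht => ?_)
    rw [Set.uIoc_of_le zero_le_one] at ht
    rw [← Real.rpow_natCast, ← Real.rpow_mul ht.1.le,
      show p + a * n - 1 = a * n + (p - 1) by ring, Real.rpow_add ht.1]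
    ring
  simp_rw [key]
  have hb : ∀ (n : ℕ) (t : ℝ), t ∈ Set.Ioc (0:ℝ) 1 → |c n * (t ^ a) ^ n| ≤ |c n| := by
    intro n t ht
    rw [abs_mul]
    have h1 : 0 ≤ t ^ a := Real.rpow_nonneg ht.1.le _
    have h2 : t ^ a ≤ 1 := Real.rpow_le_one ht.1.le ht.2 ha
    have h3 : |(t ^ a) ^ n| ≤ 1 := by
      rw [abs_of_nonneg (by positivity)]
      exact pow_le_one₀ h1 h2
    nlinarith [abs_nonneg (c n)]
  refine intervalIntegral.hasSum_integral_of_dominated_convergence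
    (fun n t => |c n| * (t ^ (p - 1) * (1 - t) ^ (r - 1))) ?_ ?_ ?_ ?_ ?_
  · intro n
    exact Measurable.aestronglyMeasurable (by fun_prop)
  · intro n
    refine Eventually.of_forall fun t ht => ?_
    rw [Set.uIoc_of_le zero_le_one] at ht
    have hw : 0 ≤ t ^ (p - 1) * (1 - t) ^ (r - 1) :=
      mul_nonneg (Real.rpow_nonneg ht.1.le _) (Real.rpow_nonneg (by linarith [ht.2]) _)
    rw [Real.norm_eq_abs, abs_mul, abs_of_nonneg hw]
    exact mul_le_mul_of_nonneg_right (hb n t ht) hw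
  · exact Eventually.of_forall fun t _ => hc.mul_right _
  · simp_rw [tsum_mul_right]
    exact (beta_integrable hp hr).const_mul _
  · refine Eventually.of_forall fun t ht => ?_
    rw [Set.uIoc_of_le zero_le_one] at ht
    refine HasSum.mul_right _ ?_
    exact (Summable.of_norm_bounded hc (fun n => hb n t ht)).hasSum

lemma Ent.shift {M : ℕ → ℝ} (h : Ent M) : Ent (fun n => M (n + 1)) := by
  refine ⟨fun n => h.1 _, fun R hR => ?_⟩
  have h1 := ((summable_nat_add_iff 1).2 (h.2 (2 * R) (by positivity))).mul_right (1 / R)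
  refine Summable.of_nonneg_of_le (fun n => mul_nonneg (by positivity) (h.1 _)) (fun n => ?_) h1
  have h2 : ((n : ℝ) + 1) ≤ 2 ^ (n + 1) := by
    exact_mod_cast (Nat.lt_two_pow_self (n := n + 1)).le
  have h3 : R ^ n / (n.factorial : ℝ) ≤ (2 * R) ^ (n + 1) / ((n + 1).factorial : ℝ) * (1 / R) := by
    rw [Nat.factorial_succ, mul_pow, pow_succ R]
    push_cast
    have : 2 ^ (n + 1) * (R ^ n * R) / (((n : ℝ) + 1) * n.factorial) * (1 / R)
        = R ^ n / (n.factorial : ℝ) * (2 ^ (n + 1) / (n + 1)) := by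
      field_simp
    rw [this]
    refine le_mul_of_one_le_right (by positivity) ?_
    rw [le_div_iff₀ (by positivity)]
    linarith
  calc _ ≤ (2 * R) ^ (n + 1) / ((n + 1).factorial : ℝ) * (1 / R) * M (n + 1) :=
        mul_le_mul_of_nonneg_right h3 (h.1 _)
    _ = _ := by ring

lemma Ent.shift_add {M : ℕ → ℝ} (h : Ent M) (j : ℕ) : Ent (fun n => M (n + j)) := by
  induction j with
  | zero => simpa using h
  | succ j ih =>
    have := ih.shift
    simpa [add_assoc, add_comm, add_left_comm] using this

lemma Ent.summable_abs {M : ℕ → ℝ} (h : Ent M) (x : ℝ) :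
    Summable (fun n : ℕ => |(-x) ^ n / n.factorial * M n|) := by
  refine Summable.of_nonneg_of_le (fun n => abs_nonneg _) (fun n => ?_)
    (h.2 (|x| + 1) (by positivity))
  rw [abs_mul, abs_div, abs_pow, abs_neg, abs_of_nonneg (h.1 n), Nat.abs_cast]
  have := h.1 n
  gcongr
  linarith

lemma Ent.summable {M : ℕ → ℝ} (h : Ent M) (x : ℝ) :
    Summable (fun n : ℕ => (-x) ^ n / n.factorial * M n) := (h.summable_abs x).of_abs

lemma Ent.hasDerivAt {M : ℕ → ℝ} (h : Ent M) (x : ℝ) :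
    HasDerivAt (L M) (-(L (fun n => M (n + 1)) x)) x := by
  set R := |x| + 1 with hR
  have hRpos : 0 < R := by positivity
  have hu : Summable (fun n : ℕ => (n : ℝ) * R ^ (n - 1) / n.factorial * M n) := by
    rw [← summable_nat_add_iff 1]
    refine (h.shift.2 R hRpos).congr fun n => ?_
    rw [Nat.factorial_succ]
    push_cast
    field_simp
  have := hasDerivAt_tsum_of_isPreconnected (𝕜 := ℝ) (F := ℝ)
    (g := fun (n : ℕ) y => (-y) ^ n / n.factorial * M n)
    (g' := fun (n : ℕ) y => -((n : ℝ) * (-y) ^ (n - 1)) / n.factorial * M n)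
    (t := Metric.ball (0:ℝ) R) (y₀ := x) (y := x) hu Metric.isOpen_ball
    (convex_ball _ _).isPreconnected ?_ ?_ (by simp [hR]) (h.summable x) (by simp [hR])
  · refine HasDerivAt.congr_deriv this ?_
    have hs : Summable (fun n : ℕ => -((n : ℝ) * (-x) ^ (n - 1)) / n.factorial * M n) := by
      rw [← summable_nat_add_iff 1]
      refine (h.shift.summable x).neg.congr fun n => ?_
      rw [Nat.factorial_succ]
      push_cast
      field_simp
    rw [hs.tsum_eq_zero_add, L, ← tsum_neg]
    simp only [Nat.cast_zero, zero_mul, neg_zero, zero_div, zero_add]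
    refine tsum_congr fun n => ?_
    rw [Nat.factorial_succ]
    push_cast
    field_simp
    try simp
  · intro n y _
    have h1 := ((hasDerivAt_neg y).pow n).div_const (n.factorial : ℝ) |>.mul_const (M n)
    refine h1.congr_deriv ?_
    ring
  · intro n y hy
    rw [Metric.mem_ball, dist_zero_right, Real.norm_eq_abs] at hy
    rw [Real.norm_eq_abs, abs_mul, abs_div, abs_neg, abs_mul, abs_pow, abs_neg,
      abs_of_nonneg (h.1 n), Nat.abs_cast, Nat.abs_cast]
    have := h.1 n
    gcongr

lemma Ent.continuous {M : ℕ → ℝ} (h : Ent M) : Continuous (L M) :=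
  continuous_iff_continuousAt.2 fun x => (h.hasDerivAt x).continuousAt

lemma L_zero (M : ℕ → ℝ) : L M 0 = M 0 := by
  rw [L, tsum_eq_single 0]
  · simp
  · intro n hn
    simp [hn]

lemma Ent.iteratedDerivWithin {M : ℕ → ℝ} (h : Ent M) (n : ℕ) :
    ∀ x ∈ Set.Ioi (0:ℝ), iteratedDerivWithin n (L M) (Set.Ioi 0) x
      = (-1) ^ n * L (fun k => M (k + n)) x := by
  induction n with
  | zero => intro x _; simp
  | succ n ih =>
    intro x hx
    rw [iteratedDerivWithin_succ, derivWithin_congr ih (ih x hx)]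
    have h1 := ((h.shift_add n).hasDerivAt x).const_mul ((-1 : ℝ) ^ n)
    rw [(h1.hasDerivWithinAt).derivWithin (isOpen_Ioi.uniqueDiffWithinAt hx)]
    have : (fun k => M (k + 1 + n)) = (fun k => M (k + (n + 1))) := by
      ext k; congr 1; omega
    rw [this]
    ring

end KS

lemma KS.cm_iff {M : ℕ → ℝ} (h : KS.Ent M) :
    ((∀ n : ℕ, DifferentiableOn ℝ (iteratedDerivWithin n (KS.L M) (Set.Ioi 0)) (Set.Ioi 0)) ∧
  ∀ n : ℕ, ∀ x ∈ Set.Ioi (0 : ℝ), 0 ≤ (-1) ^ n * iteratedDerivWithin n (KS.L M) (Set.Ioi 0) x) ↔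
    ∀ n : ℕ, ∀ x : ℝ, 0 < x → 0 ≤ KS.L (fun k => M (k + n)) x := by
  have key : ∀ (n : ℕ) (x : ℝ), (-1 : ℝ) ^ n * ((-1) ^ n * x) = x := by
    intro n x
    rw [← mul_assoc, ← mul_pow]; simp
  constructor
  · rintro ⟨-, h2⟩ n x hx
    have := h2 n x hx
    rwa [h.iteratedDerivWithin n x hx, key] at this
  · intro h2
    refine ⟨fun n => ?_, fun n x hx => ?_⟩
    · refine DifferentiableOn.congr (f := fun x => (-1) ^ n * KS.L (fun k => M (k + n)) x)
        (fun x _ => ?_) (h.iteratedDerivWithin n)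
      exact (((h.shift_add n).hasDerivAt x).const_mul ((-1 : ℝ) ^ n)).differentiableAt.differentiableWithinAt
    · rw [h.iteratedDerivWithin n x hx, key]
      exact h2 n x hx


namespace KS

lemma hs_congr {f g : ℕ → ℝ} {s : ℝ} (h : HasSum g s) (e : ∀ j, f j = g j) : HasSum f s := by
  rw [funext e]; exact h

lemma exp_antidiag (x y : ℝ) (s : ℕ) :
    ∑ p ∈ Finset.HasAntidiagonal.antidiagonal s, x ^ p.1 / (p.1.factorial : ℝ) * (y ^ p.2 / (p.2.factorial : ℝ))
      = (x + y) ^ s / (s.factorial : ℝ) := by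
  rw [(Commute.all x y).add_pow', Finset.sum_div]
  refine Finset.sum_congr rfl fun p hp => ?_
  rw [Finset.HasAntidiagonal.mem_antidiagonal] at hp
  subst hp
  rw [nsmul_eq_mul, Nat.cast_choose ℝ (Nat.le_add_right _ _), Nat.add_sub_cancel_left]
  have := Nat.factorial_ne_zero (p.1 + p.2)
  field_simp

lemma Ent.taylor {M : ℕ → ℝ} (h : Ent M) {x : ℝ} (hx : 0 < x) :
    HasSum (fun j : ℕ => x ^ j / j.factorial * L (fun k => M (k + j)) x) (M 0) := by
  let f : ℕ × ℕ → ℝ := fun p =>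
    x ^ p.1 / (p.1.factorial : ℝ) * ((-x) ^ p.2 / (p.2.factorial : ℝ) * M (p.2 + p.1))
  let e := Finset.HasAntidiagonal.sigmaAntidiagonalEquivProd (A := ℕ)
  have hfib : ∀ (y : ℝ) (s : ℕ), ∑' p : Finset.HasAntidiagonal.antidiagonal s,
      (x ^ p.1.1 / (p.1.1.factorial : ℝ) * (y ^ p.1.2 / (p.1.2.factorial : ℝ) * M (p.1.2 + p.1.1)))
      = (x + y) ^ s / (s.factorial : ℝ) * M s := by
    intro y s
    rw [tsum_fintype, Finset.sum_coe_sort (Finset.HasAntidiagonal.antidiagonal s) (fun p : ℕ × ℕ =>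
      x ^ p.1 / (p.1.factorial : ℝ) * (y ^ p.2 / (p.2.factorial : ℝ) * M (p.2 + p.1))),
      ← exp_antidiag, Finset.sum_mul]
    refine Finset.sum_congr rfl fun p hp => ?_
    rw [Finset.HasAntidiagonal.mem_antidiagonal] at hp
    rw [add_comm p.2, hp]
    ring
  have habs : Summable (fun p : ℕ × ℕ =>
      x ^ p.1 / (p.1.factorial : ℝ) * (x ^ p.2 / (p.2.factorial : ℝ) * M (p.2 + p.1))) := by
    rw [← e.summable_iff, summable_sigma_of_nonneg]
    · refine ⟨fun s => Summable.of_finite, ?_⟩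
      refine (h.2 (x + x) (by positivity)).congr fun s => ?_
      exact (hfib x s).symm
    · intro p
      have := h.1 ((e p).2 + (e p).1)
      simp only [Function.comp_apply]
      positivity
  have hf : Summable f := by
    refine Summable.of_norm_bounded habs fun p => ?_
    have := h.1 (p.2 + p.1)
    simp only [f]
    rw [Real.norm_eq_abs, abs_mul, abs_mul, abs_div, abs_div, abs_pow, abs_pow, abs_neg,
      abs_of_pos hx, abs_of_nonneg this, Nat.abs_cast, Nat.abs_cast]
  have h1 : ∑' p, f p = M 0 := by
    rw [← e.tsum_eq f, Summable.tsum_sigma' (f := fun c => f (e c)) (fun s => Summable.of_finite)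
      ((e.summable_iff (f := f)).2 hf)]
    refine (tsum_congr (fun s => hfib (-x) s)).trans ?_
    rw [tsum_eq_single 0]
    · simp
    · intro s hs
      simp [hs]
  have h2 := hf.hasSum
  rw [h1] at h2
  refine h2.prod_fiberwise fun j => ?_
  exact (((h.shift_add j).summable x).hasSum).mul_left _

lemma Ent.logconv {M : ℕ → ℝ} (h : Ent M)
    (hpos : ∀ (j : ℕ) (x : ℝ), 0 < x → 0 ≤ L (fun k => M (k + j)) x) (h0 : 0 < M 0) :
    M 1 ^ 2 ≤ M 0 * M 2 := by
  set lam := M 1 / M 0 with hlam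
  have key : ∀ x : ℝ, 0 < x → 0 ≤ M 2 + M 1 / x - 2 * lam * M 1 + lam ^ 2 * M 0 := by
    intro x hx
    set w : ℕ → ℝ := fun j => x ^ j / j.factorial * L (fun k => M (k + j)) x with hw
    have s0 : HasSum w (M 0) := h.taylor hx
    have s1 : HasSum (fun j : ℕ => (j : ℝ) / x * w j) (M 1) := by
      have t := (h.shift_add 1).taylor hx
      have := (hasSum_nat_add_iff (f := fun j : ℕ => (j : ℝ) / x * w j) (g := M 1) 1).1 (by
        refine hs_congr t fun j => ?_
        simp only [hw, Nat.factorial_succ]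
        push_cast
        rw [show (fun k => M (k + j + 1)) = (fun k => M (k + (j + 1))) from rfl]
        field_simp
        ring)
      simpa using this
    have s2 : HasSum (fun j : ℕ => (j : ℝ) * (j - 1) / x ^ 2 * w j) (M 2) := by
      have t := (h.shift_add 2).taylor hx
      have := (hasSum_nat_add_iff (f := fun j : ℕ => (j : ℝ) * (j - 1) / x ^ 2 * w j)
          (g := M 2) 2).1 (by
        refine hs_congr t fun j => ?_
        simp only [hw, Nat.factorial_succ]
        push_cast
        rw [show (fun k => M (k + j + 2)) = (fun k => M (k + (j + 2))) from rfl]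
        have : (j : ℝ) + 2 - 1 = j + 1 := by ring
        rw [this]
        field_simp
        ring)
      simpa [Finset.sum_range_succ] using this
    have s3 := ((s2.add (s1.div_const x)).sub (s1.mul_left (2 * lam))).add (s0.mul_left (lam ^ 2))
    refine s3.nonneg fun j => ?_
    have hwj : 0 ≤ w j := mul_nonneg (by positivity) (hpos j x hx)
    have : (j : ℝ) * (j - 1) / x ^ 2 * w j + (j : ℝ) / x * w j / x - 2 * lam * ((j : ℝ) / x * w j)
        + lam ^ 2 * w j = ((j : ℝ) / x - lam) ^ 2 * w j := by
      field_simp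
      ring
    simp only [this]
    positivity
  have lim : Tendsto (fun x : ℝ => M 2 + M 1 / x - 2 * lam * M 1 + lam ^ 2 * M 0) atTop
      (𝓝 (M 2 + 0 - 2 * lam * M 1 + lam ^ 2 * M 0)) := by
    refine Tendsto.add_const _ (Tendsto.sub_const (Tendsto.const_add _ ?_) _)
    exact tendsto_const_nhds.div_atTop tendsto_id
  have := ge_of_tendsto lim ((eventually_gt_atTop 0).mono key)
  have e : M 0 * (M 2 + 0 - 2 * lam * M 1 + lam ^ 2 * M 0) = M 0 * M 2 - M 1 ^ 2 := by
    rw [hlam]; field_simp; ring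
  nlinarith [mul_nonneg h0.le this]

lemma gratio {β : ℝ} (hβ : 0 < β) :
    Tendsto (fun s : ℝ => Real.Gamma s / Real.Gamma (s + β)) atTop (𝓝 0) := by
  have h1 : Tendsto (fun s : ℝ => ∫ t in (0:ℝ)..1, t ^ (s - 1) * (1 - t) ^ (β - 1)) atTop
      (𝓝 (∫ t in (0:ℝ)..1, (0:ℝ))) := by
    refine intervalIntegral.tendsto_integral_filter_of_dominated_convergence
      (fun t => t ^ ((1:ℝ) - 1) * (1 - t) ^ (β - 1)) ?_ ?_ (beta_integrable one_pos hβ) ?_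
    · exact Eventually.of_forall fun s => Measurable.aestronglyMeasurable (by fun_prop)
    · filter_upwards [eventually_ge_atTop 1] with s hs
      refine Eventually.of_forall fun t ht => ?_
      rw [Set.uIoc_of_le zero_le_one] at ht
      have hw : 0 ≤ (1 - t) ^ (β - 1) := Real.rpow_nonneg (by linarith [ht.2]) _
      rw [Real.norm_eq_abs, abs_of_nonneg (mul_nonneg (Real.rpow_nonneg ht.1.le _) hw)]
      refine mul_le_mul_of_nonneg_right ?_ hw
      exact Real.rpow_le_rpow_of_exponent_ge ht.1 ht.2 (by linarith)
    · have : ∀ᵐ t : ℝ, t ≠ 1 := by simp [ae_iff]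
      filter_upwards [this] with t ht1 ht
      rw [Set.uIoc_of_le zero_le_one] at ht
      have hlt : t < 1 := lt_of_le_of_ne ht.2 ht1
      have := (tendsto_rpow_atTop_of_base_lt_one t (by linarith [ht.1]) hlt).comp
        (tendsto_atTop_add_const_right atTop (-1 : ℝ) tendsto_id)
      have := this.mul_const ((1 - t) ^ (β - 1))
      rw [zero_mul] at this
      exact this
  rw [intervalIntegral.integral_zero] at h1
  have h2 := h1.div_const (Real.Gamma β)
  rw [zero_div] at h2
  refine h2.congr' ?_
  filter_upwards [eventually_gt_atTop 0] with s hs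
  rw [beta_integral hs hβ]
  have := (Real.Gamma_pos_of_pos hβ).ne'
  field_simp

/-- Gamma ratio coefficients. -/
noncomputable def d (α a b : ℝ) (k : ℕ) : ℝ := Real.Gamma (b + a * k) / Real.Gamma (b + a * k + α)

/-- The candidate moment sequence. -/
noncomputable def Mq (α a b q : ℝ) (n : ℕ) : ℝ := ∏ k ∈ Finset.range n, ((q + k) * d α a b k)

lemma d_pos {α a b : ℝ} (hα : 0 < α) (ha : 0 < a) (hb : 0 < b) (k : ℕ) : 0 < d α a b k :=
  div_pos (Real.Gamma_pos_of_pos (by positivity)) (Real.Gamma_pos_of_pos (by positivity))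

lemma tendsto_arg {a b : ℝ} (ha : 0 < a) : Tendsto (fun k : ℕ => b + a * (k : ℝ)) atTop atTop :=
  tendsto_atTop_add_const_left _ _ (tendsto_natCast_atTop_atTop.const_mul_atTop ha)

lemma d_tendsto {α a b : ℝ} (hα : 0 < α) (ha : 0 < a) : Tendsto (d α a b) atTop (𝓝 0) :=
  (gratio hα).comp (tendsto_arg ha)

lemma Mq_pos {α a b q : ℝ} (hα : 0 < α) (ha : 0 < a) (hb : 0 < b) (hq : 0 < q) (n : ℕ) :
    0 < Mq α a b q n :=
  Finset.prod_pos fun k _ => mul_pos (by positivity) (d_pos hα ha hb k)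

lemma tendsto_lin (q : ℝ) : Tendsto (fun k : ℕ => (q + k) / ((k : ℝ) + 1)) atTop (𝓝 1) := by
  have h1 : Tendsto (fun k : ℕ => (q - 1) * (1 / ((k : ℝ) + 1)) + 1) atTop (𝓝 ((q - 1) * 0 + 1)) :=
    (tendsto_one_div_add_atTop_nhds_zero_nat.const_mul _).add_const _
  rw [mul_zero, zero_add] at h1
  refine h1.congr fun k => ?_
  field_simp
  ring

lemma ratio_summable {v : ℕ → ℝ} (hv : ∀ k, 0 < v k) {r : ℝ} (hr : r < 1)
    {q R : ℝ} (hq : 0 < q) (hR : 0 < R) (h : Tendsto (fun k => R * v k) atTop (𝓝 r)) :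
    Summable (fun n : ℕ => R ^ n / n.factorial * ∏ k ∈ Finset.range n, ((q + k) * v k)) := by
  have hp : ∀ n, 0 < ∏ k ∈ Finset.range n, ((q + k) * v k) := fun n =>
    Finset.prod_pos fun k _ => mul_pos (by positivity) (hv k)
  refine summable_of_ratio_test_tendsto_lt_one hr (Eventually.of_forall fun n => ?_) ?_
  · have := hp n; positivity
  · have h1 := (tendsto_lin q).mul h
    rw [one_mul] at h1
    refine h1.congr fun n => ?_
    have h2 := hp n
    have h3 := hp (n + 1)
    rw [Real.norm_eq_abs, Real.norm_eq_abs, abs_of_pos (by positivity), abs_of_pos (by positivity),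
      Finset.prod_range_succ, Nat.factorial_succ]
    push_cast
    field_simp
    ring

lemma Mq_ent {α a b q : ℝ} (hα : 0 < α) (ha : 0 < a) (hb : 0 < b) (hq : 0 < q) :
    Ent (Mq α a b q) := by
  refine ⟨fun n => (Mq_pos hα ha hb hq n).le, fun R hR => ?_⟩
  have := (d_tendsto (b := b) hα ha).const_mul R
  rw [mul_zero] at this
  exact ratio_summable (d_pos hα ha hb) one_pos hq hR this

lemma Mq_shift (α a b q : ℝ) (i n : ℕ) :
    Mq α a b q (n + i) = Mq α a b q i * Mq α a (b + a * i) (q + i) n := by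
  rw [Mq, add_comm n i, Finset.prod_range_add]
  congr 1
  refine Finset.prod_congr rfl fun k _ => ?_
  rw [d, d]
  push_cast
  ring_nf

lemma L_smul (c : ℝ) (M : ℕ → ℝ) (x : ℝ) : L (fun n => c * M n) x = c * L M x := by
  rw [L, L, ← tsum_mul_left]
  exact tsum_congr fun n => by ring

/-- Necessity of `α ≤ 1`. -/
lemma alpha_le_one {α a b : ℝ} (hα : 0 < α) (ha : 0 < a) (hb : 0 < b)
    (h : ∀ (n : ℕ) (x : ℝ), 0 < x → 0 ≤ L (fun k => Mq α a b 1 (k + n)) x) : α ≤ 1 := by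
  by_contra! hα1
  have hent := Mq_ent hα ha hb one_pos
  have hmono : ∀ n : ℕ, (1 + (n : ℝ)) * d α a b n ≤ (1 + ((n + 1 : ℕ) : ℝ)) * d α a b (n + 1) := by
    intro n
    have h1 := (hent.shift_add n).logconv (fun j x hx => by
      have := h (j + n) x hx
      simpa [add_assoc] using this) (Mq_pos hα ha hb one_pos _)
    have hM := Mq_pos hα ha hb one_pos n
    have hdn := d_pos hα ha hb n
    have e1 : Mq α a b 1 (1 + n) = Mq α a b 1 n * ((1 + (n : ℝ)) * d α a b n) := by
      rw [add_comm 1 n, Mq, Finset.prod_range_succ, Mq]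
    have e2 : Mq α a b 1 (2 + n) = Mq α a b 1 n * ((1 + (n : ℝ)) * d α a b n)
        * ((1 + ((n + 1 : ℕ) : ℝ)) * d α a b (n + 1)) := by
      rw [show 2 + n = n + 1 + 1 by ring, Mq, Finset.prod_range_succ, Finset.prod_range_succ, Mq]
    simp only [zero_add, e1, e2] at h1
    have hc : 0 < Mq α a b 1 n ^ 2 * ((1 + (n : ℝ)) * d α a b n) := by positivity
    refine le_of_mul_le_mul_left ?_ hc
    nlinarith [h1]
  have hmono' : Monotone (fun n : ℕ => (1 + (n : ℝ)) * d α a b n) := monotone_nat_of_le_succ hmono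
  have hlim : Tendsto (fun n : ℕ => (1 + (n : ℝ)) * d α a b n) atTop (𝓝 0) := by
    have hβ : 0 < α - 1 := by linarith
    have t1 := d_tendsto (b := b) hβ ha
    have t2 : Tendsto (fun n : ℕ => (1 + (n : ℝ)) / (b + a * n + (α - 1))) atTop (𝓝 (1 / a)) := by
      have := ((tendsto_lin ((b + (α - 1)) / a)).inv₀ one_ne_zero).mul_const (1 / a)
      rw [inv_one, one_mul] at this
      refine this.congr fun n => ?_
      have : b + (α - 1) + a * n ≠ 0 := by positivity
      field_simp
      ring
    have t3 := t2.mul t1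
    rw [mul_zero] at t3
    refine t3.congr fun n => ?_
    have hpos : 0 < b + a * n + (α - 1) := by positivity
    rw [d, d, show b + a * (n : ℝ) + α = b + a * n + (α - 1) + 1 by ring,
      Real.Gamma_add_one hpos.ne']
    have := (Real.Gamma_pos_of_pos hpos).ne'
    field_simp
  have h0 := ge_of_tendsto hlim (Eventually.of_forall fun n => hmono' (Nat.zero_le n))
  have := d_pos hα ha hb 0
  simp at h0
  linarith

end KS


namespace KS

lemma prod_one_add (n : ℕ) : ∏ k ∈ Finset.range n, (1 + (k : ℝ)) = n.factorial := by
  induction n with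
  | zero => simp
  | succ n ih =>
    rw [Finset.prod_range_succ, ih, Nat.factorial_succ]
    push_cast
    ring

lemma Mq_one (α a b : ℝ) (n : ℕ) :
    Mq α a b 1 n = n.factorial * ∏ k ∈ Finset.range n, d α a b k := by
  rw [Mq, Finset.prod_mul_distrib, prod_one_add]

/-- Necessity of `a ≤ b`. -/
lemma a_le_b {α a b : ℝ} (hα : 0 < α) (ha : 0 < a) (hb : 0 < b)
    (h : ∀ (x : ℝ), 0 < x → 0 ≤ L (Mq α a b 1) x) : a ≤ b := by
  by_contra! hab
  have hent := Mq_ent hα ha hb one_pos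
  have hG := Real.Gamma_pos_of_pos hα
  set F := L (Mq α a b 1) with hF
  have hFc : Continuous F := hent.continuous
  have hF0 : F 0 = 1 := by rw [hF, L_zero]; simp [Mq]
  -- the integral equation
  have hIeq : ∀ x : ℝ, 0 < x →
      ∫ t in (0:ℝ)..1, F (x * t ^ a) * (t ^ (b - 1) * (1 - t) ^ (α - 1))
        = Real.Gamma α * (1 - F x) / x := by
    intro x hx
    have hs := swap (fun n => (-x) ^ n / n.factorial * Mq α a b 1 n) (hent.summable_abs x) hb hα ha.le
    have e1 : ∀ t : ℝ, ∑' n : ℕ, (-x) ^ n / n.factorial * Mq α a b 1 n * (t ^ a) ^ n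
        = F (x * t ^ a) := by
      intro t
      rw [hF, L]
      refine tsum_congr fun n => ?_
      rw [← neg_mul, mul_pow]
      ring
    simp_rw [e1] at hs
    rw [← hs.tsum_eq]
    have e2 : F x = 1 + ∑' n : ℕ, (-x) ^ (n + 1) / (n + 1).factorial * Mq α a b 1 (n + 1) := by
      rw [hF, L, (hent.summable x).tsum_eq_zero_add]
      simp [Mq]
    have e3 : ∑' n : ℕ, (-x) ^ (n + 1) / (n + 1).factorial * Mq α a b 1 (n + 1)
        = (-x / Real.Gamma α) * ∑' n : ℕ, (-x) ^ n / n.factorial * Mq α a b 1 n *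
          (Real.Gamma (b + a * n) * Real.Gamma α / Real.Gamma (b + a * n + α)) := by
      rw [← tsum_mul_left]
      refine tsum_congr fun n => ?_
      rw [Mq_one, Mq_one, Finset.prod_range_succ, d, Nat.factorial_succ]
      push_cast
      field_simp
      ring
    rw [e3] at e2
    rw [e2]
    generalize (∑' n : ℕ, (-x) ^ n / n.factorial * Mq α a b 1 n *
          (Real.Gamma (b + a * n) * Real.Gamma α / Real.Gamma (b + a * n + α))) = S
    field_simp
    ring
  -- neighbourhood of zero
  obtain ⟨η, hη, hFη⟩ : ∃ η > 0, ∀ y, |y| ≤ η → 1 / 2 ≤ F y := by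
    have : ∀ᶠ y in 𝓝 (0:ℝ), 1 / 2 < F y :=
      hFc.continuousAt.eventually (lt_mem_nhds (by rw [hF0]; norm_num))
    obtain ⟨η, hη, h1⟩ := Metric.eventually_nhds_iff.1 this
    refine ⟨η / 2, by positivity, fun y hy => (h1 ?_).le⟩
    rw [dist_zero_right, Real.norm_eq_abs]; linarith
  obtain ⟨δ, hδ, hwδ⟩ : ∃ δ > 0, ∀ t : ℝ, |t| ≤ δ → 1 / 2 ≤ (1 - t) ^ (α - 1) := by
    have hc : ContinuousAt (fun t : ℝ => (1 - t) ^ (α - 1)) 0 :=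
      ContinuousAt.rpow_const (by fun_prop) (Or.inl (by norm_num))
    have : ∀ᶠ t in 𝓝 (0:ℝ), 1 / 2 < (1 - t) ^ (α - 1) :=
      hc.eventually (lt_mem_nhds (by norm_num))
    obtain ⟨η, hη, h1⟩ := Metric.eventually_nhds_iff.1 this
    refine ⟨η / 2, by positivity, fun y hy => (h1 ?_).le⟩
    rw [dist_zero_right, Real.norm_eq_abs]; linarith
  have hFnn : ∀ y, 0 ≤ y → 0 ≤ F y := by
    intro y hy
    rcases hy.eq_or_lt with rfl | hy
    · rw [hF0]; norm_num
    · exact h y hy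
  have bound : ∀ ε : ℝ, 0 < ε → ε ≤ δ → ε < 1 →
      ε ^ (b - a) ≤ Real.Gamma α * (4 * b) / η := by
    intro ε hε hεδ hε1
    set x := η * ε ^ (-a) with hx
    have hεa : 0 < ε ^ (-a) := Real.rpow_pos_of_pos hε _
    have hxpos : 0 < x := by positivity
    have hI := hIeq x hxpos
    have hii : IntervalIntegrable
        (fun t => F (x * t ^ a) * (t ^ (b - 1) * (1 - t) ^ (α - 1))) volume 0 1 := by
      refine (beta_integrable hb hα).continuousOn_mul ?_
      refine (hFc.comp (continuous_const.mul (Real.continuous_rpow_const ha.le))).continuousOn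
    have h1 : ∫ t in (0:ℝ)..ε, F (x * t ^ a) * (t ^ (b - 1) * (1 - t) ^ (α - 1))
        ≤ ∫ t in (0:ℝ)..1, F (x * t ^ a) * (t ^ (b - 1) * (1 - t) ^ (α - 1)) := by
      refine intervalIntegral.integral_mono_interval le_rfl hε.le hε1.le ?_ hii
      rw [EventuallyLE, ae_restrict_iff' measurableSet_Ioc]
      refine Eventually.of_forall fun t ht => ?_
      exact mul_nonneg (hFnn _ (mul_nonneg hxpos.le (Real.rpow_nonneg ht.1.le _)))
        (mul_nonneg (Real.rpow_nonneg ht.1.le _) (Real.rpow_nonneg (by linarith [ht.2]) _))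
    have h2 : ∫ t in (0:ℝ)..ε, (1 / 4) * t ^ (b - 1)
        ≤ ∫ t in (0:ℝ)..ε, F (x * t ^ a) * (t ^ (b - 1) * (1 - t) ^ (α - 1)) := by
      refine intervalIntegral.integral_mono_on_of_le_Ioo hε.le ?_ ?_ ?_
      · exact (intervalIntegral.intervalIntegrable_rpow' (by linarith)).const_mul _
      · refine hii.mono_set ?_
        rw [Set.uIcc_of_le hε.le, Set.uIcc_of_le zero_le_one]
        exact Set.Icc_subset_Icc le_rfl hε1.le
      · intro t ht
        have ht0 : 0 ≤ t ^ (b - 1) := Real.rpow_nonneg ht.1.le _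
        have hta : 0 ≤ t ^ a := Real.rpow_nonneg ht.1.le _
        have g1 : 1 / 2 ≤ F (x * t ^ a) := by
          apply hFη
          rw [abs_of_nonneg (by positivity)]
          have : t ^ a ≤ ε ^ a := Real.rpow_le_rpow ht.1.le ht.2.le ha.le
          calc x * t ^ a ≤ x * ε ^ a := by gcongr
            _ = η := by
              rw [hx, mul_assoc, ← Real.rpow_add hε]; simp
        have g2 := hwδ t (by rw [abs_of_pos ht.1]; linarith [ht.2])
        have g3 : 1 / 4 ≤ F (x * t ^ a) * (1 - t) ^ (α - 1) := by nlinarith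
        calc _ ≤ (F (x * t ^ a) * (1 - t) ^ (α - 1)) * t ^ (b - 1) := by gcongr
          _ = _ := by ring
    have h3 : ∫ t in (0:ℝ)..ε, (1 / 4) * t ^ (b - 1) = (1 / 4) * (ε ^ b / b) := by
      rw [intervalIntegral.integral_const_mul, integral_rpow (Or.inl (by linarith))]
      simp [hb.ne']
    have h4 : Real.Gamma α * (1 - F x) / x ≤ Real.Gamma α / x := by
      gcongr
      nlinarith [hFnn x hxpos.le]
    have h5 : (1 / 4) * (ε ^ b / b) ≤ Real.Gamma α / x := by linarith
    rw [le_div_iff₀ hxpos] at h5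
    rw [le_div_iff₀ hη, sub_eq_add_neg, Real.rpow_add hε]
    have h6 : 1 / 4 * (ε ^ b / b) * x = (ε ^ b * ε ^ (-a) * η) / (4 * b) := by
      rw [hx]; field_simp
    rw [h6, div_le_iff₀ (by positivity)] at h5
    exact h5
  have hlim := tendsto_rpow_neg_nhdsGT_zero (y := b - a) (by linarith)
  have ev1 := hlim.eventually (eventually_gt_atTop (Real.Gamma α * (4 * b) / η))
  have ev2 : ∀ᶠ ε : ℝ in 𝓝[>] 0, ε ∈ Set.Ioo 0 (min δ 1) :=
    Ioo_mem_nhdsGT (lt_min hδ one_pos)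
  obtain ⟨ε, h1, h2⟩ := (ev1.and ev2).exists
  have := bound ε h2.1 (h2.2.le.trans (min_le_left _ _)) (h2.2.trans_le (min_le_right _ _))
  linarith

end KS


namespace KS

/-- Moments of scaled products of independent beta variables. -/
noncomputable def P (A : ℝ) (p q : ℕ → ℝ) (N n : ℕ) : ℝ :=
  A ^ n * ∏ k ∈ Finset.range n, ∏ j ∈ Finset.range N, ((p j + k) / (q j + k))

lemma P_ent {A : ℝ} (hA : 0 ≤ A) {p q : ℕ → ℝ} (hp : ∀ j, 0 < p j) (hpq : ∀ j, p j ≤ q j) (N : ℕ) :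
    Ent (P A p q N) := by
  have hq : ∀ j, 0 < q j := fun j => (hp j).trans_le (hpq j)
  have h0 : ∀ (k j : ℕ), 0 ≤ (p j + k) / (q j + k) := fun k j => by
    have := hp j; have := hq j; positivity
  have h1 : ∀ (k j : ℕ), (p j + k) / (q j + k) ≤ 1 := fun k j => by
    have := hp j; have := hq j
    rw [div_le_one (by positivity)]; linarith [hpq j]
  have hP0 : ∀ n, 0 ≤ P A p q N n := fun n =>
    mul_nonneg (by positivity) (Finset.prod_nonneg fun k _ => Finset.prod_nonneg fun j _ => h0 k j)
  refine ⟨hP0, fun R hR => ?_⟩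
  refine Summable.of_nonneg_of_le (fun n => mul_nonneg (by positivity) (hP0 n)) (fun n => ?_)
    (Real.summable_pow_div_factorial (R * A))
  have : P A p q N n ≤ A ^ n := by
    refine mul_le_of_le_one_right (by positivity) ?_
    refine Finset.prod_le_one (fun k _ => Finset.prod_nonneg fun j _ => h0 k j) fun k _ => ?_
    exact Finset.prod_le_one (fun j _ => h0 k j) fun j _ => h1 k j
  calc _ ≤ R ^ n / (n.factorial : ℝ) * A ^ n := by gcongr
    _ = _ := by rw [mul_pow]; ring

lemma Gamma_add_nat {p : ℝ} (hp : 0 < p) (n : ℕ) :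
    Real.Gamma (p + n) = Real.Gamma p * ∏ k ∈ Finset.range n, (p + k) := by
  induction n with
  | zero => simp
  | succ n ih =>
    rw [Finset.prod_range_succ, ← mul_assoc, ← ih]
    push_cast
    rw [← add_assoc, Real.Gamma_add_one (by positivity)]
    ring

lemma P_pos {A : ℝ} (hA : 0 ≤ A) {p q : ℕ → ℝ} (hp : ∀ j, 0 < p j) (hpq : ∀ j, p j ≤ q j) (N : ℕ) :
    ∀ x : ℝ, 0 ≤ x → 0 ≤ L (P A p q N) x := by
  induction N with
  | zero =>
    intro x _
    have : L (P A p q 0) x = Real.exp (-x * A) := by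
      rw [L, Real.exp_eq_exp_ℝ, NormedSpace.exp_eq_tsum_div]
      refine tsum_congr fun n => ?_
      simp only [P, Finset.range_zero, Finset.prod_empty, Finset.prod_const_one, mul_one, mul_pow]
      ring
    rw [this]
    positivity
  | succ N ih =>
    intro x hx
    have hs : ∀ n, P A p q (N + 1) n
        = P A p q N n * ∏ k ∈ Finset.range n, ((p N + k) / (q N + k)) := by
      intro n
      simp only [P, Finset.prod_range_succ _ N, Finset.prod_mul_distrib]
      ring
    rcases (hpq N).eq_or_lt with heq | hlt
    · have : P A p q (N + 1) = P A p q N := by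
        ext n
        rw [hs, heq]
        have : ∏ k ∈ Finset.range n, ((q N + (k : ℝ)) / (q N + k)) = 1 := by
          refine Finset.prod_eq_one fun k _ => ?_
          have : 0 < q N := (hp N).trans_le (hpq N)
          exact div_self (by positivity)
        rw [this, mul_one]
      rw [this]
      exact ih x hx
    · have hr : 0 < q N - p N := by linarith
      have hqN : 0 < q N := (hp N).trans hlt
      have h1 := swap (fun n => (-x) ^ n / n.factorial * P A p q N n)
        ((P_ent hA hp hpq N).summable_abs x) (hp N) hr zero_le_one
      set B := Real.Gamma (p N) * Real.Gamma (q N - p N) / Real.Gamma (q N) with hB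
      have hBpos : 0 < B := div_pos (mul_pos (Real.Gamma_pos_of_pos (hp N))
        (Real.Gamma_pos_of_pos hr)) (Real.Gamma_pos_of_pos hqN)
      have e1 : ∑' n : ℕ, (-x) ^ n / n.factorial * P A p q N n *
          (Real.Gamma (p N + 1 * n) * Real.Gamma (q N - p N)
            / Real.Gamma (p N + 1 * n + (q N - p N))) = L (P A p q (N + 1)) x * B := by
        rw [L, ← tsum_mul_right]
        refine tsum_congr fun n => ?_
        rw [hs, one_mul, show p N + (n : ℝ) + (q N - p N) = q N + n by ring,
          Gamma_add_nat (hp N), Gamma_add_nat hqN, Finset.prod_div_distrib, hB]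
        have g1 := (Real.Gamma_pos_of_pos hqN).ne'
        have g2 : ∏ k ∈ Finset.range n, (q N + (k : ℝ)) ≠ 0 :=
          (Finset.prod_pos fun k _ => by positivity).ne'
        field_simp
      rw [h1.tsum_eq] at e1
      have e2 : 0 ≤ L (P A p q (N + 1)) x * B := by
        rw [← e1]
        refine intervalIntegral.integral_nonneg zero_le_one fun t ht => ?_
        have e3 : ∑' n : ℕ, (-x) ^ n / n.factorial * P A p q N n * (t ^ (1:ℝ)) ^ n
            = L (P A p q N) (x * t) := by
          rw [L]
          refine tsum_congr fun n => ?_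
          rw [Real.rpow_one, ← neg_mul, mul_pow]
          ring
        rw [e3]
        exact mul_nonneg (ih _ (mul_nonneg hx ht.1))
          (mul_nonneg (Real.rpow_nonneg ht.1 _) (Real.rpow_nonneg (by linarith [ht.2]) _))
      exact nonneg_of_mul_nonneg_left e2 hBpos

/-- Euler approximation of the Gamma ratio. -/
noncomputable def g (α : ℝ) (N : ℕ) (s : ℝ) : ℝ :=
  (N : ℝ) ^ (1 - α) * (∏ j ∈ Finset.range N, (s + α + j)) / ∏ j ∈ Finset.range (N + 1), (s + j)

lemma g_nonneg {α : ℝ} (hα : 0 < α) (N : ℕ) {s : ℝ} (hs : 0 < s) : 0 ≤ g α N s := by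
  unfold g
  have h1 : 0 ≤ ∏ j ∈ Finset.range N, (s + α + (j : ℝ)) :=
    Finset.prod_nonneg fun j _ => by positivity
  have h2 : 0 ≤ ∏ j ∈ Finset.range (N + 1), (s + (j : ℝ)) :=
    Finset.prod_nonneg fun j _ => by positivity
  positivity

lemma g_tendsto {α s : ℝ} (hα : 0 < α) (hs : 0 < s) :
    Tendsto (fun N => g α N s) atTop (𝓝 (Real.Gamma s / Real.Gamma (s + α))) := by
  have h1 := (Real.GammaSeq_tendsto_Gamma s).div (Real.GammaSeq_tendsto_Gamma (s + α))
    (Real.Gamma_pos_of_pos (by positivity)).ne'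
  have h2 : Tendsto (fun N : ℕ => (N : ℝ) / (s + α + N)) atTop (𝓝 1) := by
    have : Tendsto (fun N : ℕ => 1 - (s + α) / (s + α + (N : ℝ))) atTop (𝓝 (1 - 0)) :=
      tendsto_const_nhds.sub (tendsto_const_nhds.div_atTop
        (tendsto_atTop_add_const_left _ _ tendsto_natCast_atTop_atTop))
    rw [sub_zero] at this
    refine this.congr fun N => ?_
    have : s + α + (N : ℝ) ≠ 0 := by positivity
    field_simp
    ring
  have h3 := h1.mul h2
  rw [mul_one] at h3
  refine h3.congr' ?_
  filter_upwards [eventually_gt_atTop 0] with N hN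
  have hN' : (0:ℝ) < N := by exact_mod_cast hN
  simp only [Pi.div_apply, Real.GammaSeq, g]
  rw [Finset.prod_range_succ (fun j : ℕ => s + α + (j : ℝ)) N, Real.rpow_add hN',
    Real.rpow_sub hN', Real.rpow_one]
  have p1 : 0 < ∏ j ∈ Finset.range (N + 1), (s + (j : ℝ)) :=
    Finset.prod_pos fun j _ => by positivity
  have p2 : 0 < ∏ j ∈ Finset.range N, (s + α + (j : ℝ)) :=
    Finset.prod_pos fun j _ => by positivity
  have p3 : 0 < (N : ℝ) ^ s := Real.rpow_pos_of_pos hN' _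
  have p4 : 0 < (N : ℝ) ^ α := Real.rpow_pos_of_pos hN' _
  have p5 : 0 < s + α + (N : ℝ) := by positivity
  have p6 : (N.factorial : ℝ) ≠ 0 := by positivity
  field_simp

lemma g_anti {α : ℝ} (hα : 0 < α) (N : ℕ) {s s' : ℝ} (hs : 0 < s) (hss : s ≤ s') :
    g α N s' ≤ g α N s := by
  have e : ∀ u : ℝ, 0 < u → g α N u = (N : ℝ) ^ (1 - α) *
      (∏ j ∈ Finset.range N, ((u + α + j) / (u + j))) * (1 / (u + N)) := by
    intro u hu
    rw [g, Finset.prod_range_succ, Finset.prod_div_distrib]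
    have p1 : 0 < ∏ j ∈ Finset.range N, (u + (j : ℝ)) :=
      Finset.prod_pos fun j _ => by positivity
    field_simp
  have hs' : 0 < s' := hs.trans_le hss
  rw [e s hs, e s' hs']
  have hprod : ∏ j ∈ Finset.range N, ((s' + α + (j : ℝ)) / (s' + j))
      ≤ ∏ j ∈ Finset.range N, ((s + α + (j : ℝ)) / (s + j)) := by
    refine Finset.prod_le_prod (fun j _ => by positivity) fun j _ => ?_
    rw [div_le_div_iff₀ (by positivity) (by positivity)]
    nlinarith
  have h0 : 0 ≤ ∏ j ∈ Finset.range N, ((s' + α + (j : ℝ)) / (s' + j)) :=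
    Finset.prod_nonneg fun j _ => by positivity
  gcongr

lemma approx_pos {α a b q : ℝ} (hα : 0 < α) (hα1 : α ≤ 1) (ha : 0 < a) (hb : 0 < b) (hq : 0 < q)
    (hqb : a * q ≤ b) (N : ℕ) {x : ℝ} (hx : 0 ≤ x) :
    0 ≤ L (fun n => ∏ k ∈ Finset.range n, ((q + k) * g α N (b + a * k))) x := by
  let p' : ℕ → ℝ := fun j => Nat.casesOn j q (fun i => (b + α + i) / a)
  let q' : ℕ → ℝ := fun j => Nat.casesOn j (b / a) (fun i => (b + i + 1) / a)
  have hp' : ∀ j, 0 < p' j := by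
    intro j
    cases j with
    | zero => exact hq
    | succ i => change 0 < (b + α + i) / a; positivity
  have hpq' : ∀ j, p' j ≤ q' j := by
    intro j
    cases j with
    | zero => change q ≤ b / a; rw [le_div_iff₀ ha]; linarith
    | succ i => change (b + α + i) / a ≤ (b + i + 1) / a; gcongr ?_ / _; linarith
  have key : (fun n => ∏ k ∈ Finset.range n, ((q + k) * g α N (b + a * k)))
      = P ((N : ℝ) ^ (1 - α) / a) p' q' (N + 1) := by
    ext n
    have hc : ((N : ℝ) ^ (1 - α) / a) ^ n = ∏ _k ∈ Finset.range n, ((N : ℝ) ^ (1 - α) / a) := by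
      rw [Finset.prod_const, Finset.card_range]
    rw [P, hc, ← Finset.prod_mul_distrib]
    refine Finset.prod_congr rfl fun k _ => ?_
    rw [Finset.prod_range_succ']
    change _ = (N : ℝ) ^ (1 - α) / a *
      ((∏ j ∈ Finset.range N, (((b + α + j) / a + k) / ((b + j + 1) / a + k)))
        * ((q + k) / (b / a + k)))
    have e1 : ∀ j ∈ Finset.range N, ((b + α + (j : ℝ)) / a + k) / ((b + j + 1) / a + k)
        = (b + a * k + α + j) / (b + a * k + ((j + 1 : ℕ) : ℝ)) := by
      intro j _
      push_cast
      have : b + (j : ℝ) + 1 + a * k ≠ 0 := by positivity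
      have : b + a * k + ((j : ℝ) + 1) ≠ 0 := by positivity
      field_simp
      ring
    rw [Finset.prod_congr rfl e1, Finset.prod_div_distrib, g, Finset.prod_range_succ']
    have p1 : 0 < ∏ j ∈ Finset.range N, (b + a * k + ((j + 1 : ℕ) : ℝ)) :=
      Finset.prod_pos fun j _ => by positivity
    have p2 : b + a * (k : ℝ) ≠ 0 := by positivity
    have p3 : b / a + (k : ℝ) = (b + a * k) / a := by field_simp
    rw [p3, Nat.cast_zero, add_zero]
    field_simp
  rw [key]
  exact P_pos (by positivity) hp' hpq' (N + 1) x hx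

lemma main_pos {α a b q : ℝ} (hα : 0 < α) (hα1 : α ≤ 1) (ha : 0 < a) (hb : 0 < b) (hq : 0 < q)
    (hqb : a * q ≤ b) {x : ℝ} (hx : 0 < x) : 0 ≤ L (Mq α a b q) x := by
  have hg : ∀ k : ℕ, Tendsto (fun N => g α N (b + a * k)) atTop (𝓝 (d α a b k)) := fun k =>
    g_tendsto hα (by positivity)
  set ε := 1 / (2 * x) with hε
  have hεpos : 0 < ε := by positivity
  obtain ⟨K, hK⟩ := ((d_tendsto (b := b) hα ha).eventually (gt_mem_nhds hεpos)).exists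
  have hd0 := d_pos hα ha hb 0
  let D : ℕ → ℝ := fun k => if k < K then d α a b 0 + 1 else ε
  have hD : ∀ k, 0 < D k := by
    intro k
    simp only [D]
    split_ifs <;> positivity
  have hsum : Summable (fun n : ℕ => x ^ n / n.factorial * ∏ k ∈ Finset.range n, ((q + k) * D k)) := by
    refine ratio_summable hD (r := 1 / 2) (by norm_num) hq hx ?_
    refine tendsto_const_nhds.congr' ?_
    filter_upwards [eventually_ge_atTop K] with k hk
    simp only [D, if_neg (not_lt.2 hk), hε]
    field_simp
  have hlim : Tendsto (fun N => L (fun n => ∏ k ∈ Finset.range n, ((q + k) * g α N (b + a * k))) x)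
      atTop (𝓝 (L (Mq α a b q) x)) := by
    refine tendsto_tsum_of_dominated_convergence hsum (fun n => ?_) ?_
    · refine Tendsto.const_mul _ ?_
      exact tendsto_finsetProd _ fun k _ => (hg k).const_mul _
    · filter_upwards [(hg 0).eventually (gt_mem_nhds (lt_add_one _)),
        (hg K).eventually (gt_mem_nhds hK)] with N h0 h1 n
      have hgn : ∀ k : ℕ, 0 ≤ g α N (b + a * k) := fun k => g_nonneg hα N (by positivity)
      have hgD : ∀ k : ℕ, g α N (b + a * k) ≤ D k := by
        intro k
        simp only [D]
        split_ifs with hk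
        · refine le_trans (g_anti hα N (by positivity) ?_) h0.le
          simp; positivity
        · refine le_trans (g_anti hα N (by positivity) ?_) h1.le
          have : (K : ℝ) ≤ k := by exact_mod_cast not_lt.1 hk
          gcongr
      have hpn : 0 ≤ ∏ k ∈ Finset.range n, ((q + k) * g α N (b + a * k)) :=
        Finset.prod_nonneg fun k _ => mul_nonneg (by positivity) (hgn k)
      rw [Real.norm_eq_abs, abs_mul, abs_div, abs_pow, abs_neg, abs_of_pos hx, Nat.abs_cast,
        abs_of_nonneg hpn]
      refine mul_le_mul_of_nonneg_left ?_ (by positivity)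
      refine Finset.prod_le_prod (fun k _ => mul_nonneg (by positivity) (hgn k)) fun k _ => ?_
      exact mul_le_mul_of_nonneg_left (hgD k) (by positivity)
  exact ge_of_tendsto' hlim fun N => approx_pos hα hα1 ha hb hq hqb N hx.le

end KS


theorem kilbasSaigo_completelyMonotone_iff (α m l : ℝ)
    (hα : 0 < α) (hm : 0 < m) (hl : -1 / α < l) :
    CompletelyMonotoneOn (fun x => kilbasSaigo α m l (-x)) ↔ (α ≤ 1 ∧ m - 1 / α ≤ l) := by
  have ha : 0 < α * m := by positivity
  have hb : 0 < 1 + α * l := by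
    rw [div_lt_iff₀ hα] at hl
    linarith
  have hcond : m - 1 / α ≤ l ↔ α * m ≤ 1 + α * l := by
    rw [← mul_le_mul_iff_right₀ hα, mul_sub, mul_one_div_cancel hα.ne']
    constructor <;> intro h <;> linarith
  have hent := KS.Mq_ent hα ha hb one_pos
  have hF : (fun x => kilbasSaigo α m l (-x)) = KS.L (KS.Mq α (α * m) (1 + α * l) 1) := by
    ext x
    rw [kilbasSaigo, KS.L]
    refine tsum_congr fun n => ?_
    rw [KS.Mq_one]
    have : ∏ k ∈ Finset.range n, Real.Gamma (1 + α * (k * m + l)) /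
        Real.Gamma (1 + α * (k * m + l + 1))
        = ∏ k ∈ Finset.range n, KS.d α (α * m) (1 + α * l) k := by
      refine Finset.prod_congr rfl fun k _ => ?_
      rw [KS.d]
      congr 2 <;> ring
    rw [this]
    field_simp
  rw [hF, CompletelyMonotoneOn, KS.cm_iff hent, hcond]
  constructor
  · intro h
    refine ⟨KS.alpha_le_one hα ha hb h, KS.a_le_b hα ha hb fun x hx => ?_⟩
    simpa using h 0 x hx
  · rintro ⟨h1, h2⟩ n x hx
    have : (fun k => KS.Mq α (α * m) (1 + α * l) 1 (k + n)) = fun k =>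
        KS.Mq α (α * m) (1 + α * l) 1 n *
          KS.Mq α (α * m) (1 + α * l + α * m * n) (1 + n) k := by
      ext k
      exact KS.Mq_shift _ _ _ _ _ _
    rw [this, KS.L_smul]
    refine mul_nonneg (KS.Mq_pos hα ha hb one_pos n).le ?_
    refine KS.main_pos hα h1 ha (by positivity) (by positivity) ?_ hx
    nlinarith
end

section
/- For every α ∈ (0,1), m > 0 and x ≥ 0, one has 1/(1 + Γ(1−α) x) ≤ E_{α,m,m−1}(−x) ≤ 1/(1 + (Γ(1 + α(m−1))/Γ(1 + αm)) x). -/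
open MeasureTheory Set Filter Topology

lemma ks_beta {u v : ℝ} (hu : 0 < u) (hv : 0 < v) :
    IntegrableOn (fun x : ℝ => x ^ (u - 1) * (1 - x) ^ (v - 1)) (Ioo 0 1) ∧
    ∫ x in Ioo (0 : ℝ) 1, x ^ (u - 1) * (1 - x) ^ (v - 1) =
      Real.Gamma u * Real.Gamma v / Real.Gamma (u + v) := by
  have h1 := Complex.betaIntegral_convergent (u := (u : ℂ)) (v := (v : ℂ)) (by simpa) (by simpa)
  rw [intervalIntegrable_iff_integrableOn_Ioo_of_le zero_le_one] at h1
  have hEq : EqOn (fun x : ℝ => (x : ℂ) ^ ((u : ℂ) - 1) * (1 - (x : ℂ)) ^ ((v : ℂ) - 1))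
      (fun x : ℝ => ((x ^ (u - 1) * (1 - x) ^ (v - 1) : ℝ) : ℂ)) (Ioo 0 1) := by
    intro x hx
    simp only [Complex.ofReal_mul]
    rw [Complex.ofReal_cpow hx.1.le, Complex.ofReal_cpow (sub_nonneg.2 hx.2.le)]
    push_cast
    rfl
  have h2 := (integrableOn_congr_fun hEq measurableSet_Ioo).1 h1
  refine ⟨?_, ?_⟩
  · unfold IntegrableOn at h2 ⊢
    simpa using h2.re
  · have h3 := ProbabilityTheory.beta_eq_betaIntegralReal u v hu hv
    rw [Complex.betaIntegral, intervalIntegral.integral_of_le zero_le_one,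
      integral_Ioc_eq_integral_Ioo, setIntegral_congr_fun measurableSet_Ioo hEq,
      integral_complex_ofReal, Complex.ofReal_re] at h3
    exact h3.symm

lemma ks_bern {z u : ℝ} (hz : 0 ≤ z) (h0 : 0 < u) (h1 : u < 1) :
    0 ≤ 1 - u ^ z ∧ 1 - u ^ z ≤ (1 + z) * (1 - u) := by
  refine ⟨sub_nonneg.2 (Real.rpow_le_one h0.le h1.le hz), ?_⟩
  rcases le_total 1 z with h | h
  · have := one_add_mul_self_le_rpow_one_add (s := u - 1) (by linarith) h
    rw [add_sub_cancel] at this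
    nlinarith
  · have := Real.rpow_le_rpow_of_exponent_ge h0 h1.le h
    rw [Real.rpow_one] at this
    nlinarith

lemma ks_nu {α z : ℝ} (hα : 0 < α) (hα1 : α < 1) (hz : 0 ≤ z) :
    IntegrableOn (fun u : ℝ => (1 - u ^ z) * (α * (1 - u) ^ (-α - 1))) (Ioo 0 1) ∧
    ∫ u in Ioo (0 : ℝ) 1, (1 - u ^ z) * (α * (1 - u) ^ (-α - 1)) =
      Real.Gamma (1 - α) * (Real.Gamma (1 + z) / Real.Gamma (1 + z - α)) - 1 := by
  rcases hz.eq_or_lt with rfl | hz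
  · have : Real.Gamma (1 - α) ≠ 0 := (Real.Gamma_pos_of_pos (by linarith)).ne'
    simp [this]
  obtain ⟨b1, b2⟩ := ks_beta (u := z) (v := 1 - α) hz (by linarith)
  obtain ⟨b3, b4⟩ := ks_beta (u := z) (v := 1) hz one_pos
  obtain ⟨b5, -⟩ := ks_beta (u := 1) (v := 1 - α) one_pos (by linarith)
  have e1 : 1 - α - 1 = -α := by ring
  simp only [e1, sub_self, Real.rpow_zero, mul_one, one_mul] at b1 b2 b3 b4 b5
  have key : ∀ u ∈ Ioo (0:ℝ) 1, (1 - u) ^ (-α - 1) * (1 - u) = (1 - u) ^ (-α) := by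
    intro u hu
    have h : 0 < 1 - u := by linarith [hu.2]
    rw [← Real.rpow_add_one h.ne']; congr 1; ring
  have hI : IntegrableOn (fun u : ℝ => (1 - u ^ z) * (α * (1 - u) ^ (-α - 1))) (Ioo 0 1) := by
    refine Integrable.mono' (b5.const_mul (α * (1 + z))) ?_ ?_
    · exact (by fun_prop : Measurable fun u : ℝ => (1 - u ^ z) * (α * (1 - u) ^ (-α - 1))).aestronglyMeasurable
    · refine (ae_restrict_mem measurableSet_Ioo).mono fun u hu => ?_
      obtain ⟨p1, p2⟩ := ks_bern hz.le hu.1 hu.2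
      have h : 0 < 1 - u := by linarith [hu.2]
      have hp := Real.rpow_pos_of_pos h (-α - 1)
      rw [Real.norm_of_nonneg (by positivity), ← key u hu]
      calc _ ≤ (1 + z) * (1 - u) * (α * (1 - u) ^ (-α - 1)) := by gcongr
        _ = _ := by ring
  refine ⟨hI, ?_⟩
  have hJ : IntegrableOn (fun u : ℝ => z * (u ^ (z - 1) * (1 - u) ^ (-α) - u ^ (z - 1))) (Ioo 0 1) :=
    (b1.sub b3).const_mul z
  have ftc := intervalIntegral.integral_eq_sub_of_hasDerivAt_of_tendsto (a := 0) (b := 1)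
    (f := fun u : ℝ => (1 - u ^ z) * ((1 - u) ^ (-α) - 1))
    (f' := fun u : ℝ => (1 - u ^ z) * (α * (1 - u) ^ (-α - 1)) -
      z * (u ^ (z - 1) * (1 - u) ^ (-α) - u ^ (z - 1))) (fa := 0) (fb := 0) zero_lt_one ?_ ?_ ?_ ?_
  · rw [intervalIntegral.integral_of_le zero_le_one, integral_Ioc_eq_integral_Ioo,
      integral_sub hI hJ, integral_const_mul, integral_sub b1 b3, b2, b4] at ftc
    have g1 : Real.Gamma (1 + z) = z * Real.Gamma z := by
      rw [add_comm, Real.Gamma_add_one hz.ne']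
    have g2 : Real.Gamma (z + 1) = z * Real.Gamma z := by
      rw [Real.Gamma_add_one hz.ne']
    have g3 : Real.Gamma z ≠ 0 := (Real.Gamma_pos_of_pos hz).ne'
    have g4 : Real.Gamma (1 + z - α) ≠ 0 := (Real.Gamma_pos_of_pos (by linarith)).ne'
    rw [g2, Real.Gamma_one, show z + (1 - α) = 1 + z - α by ring] at ftc
    rw [g1]
    have : z * (Real.Gamma z * Real.Gamma (1 - α) / Real.Gamma (1 + z - α) -
       Real.Gamma z * 1 / (z * Real.Gamma z)) = Real.Gamma (1 - α) * (z * Real.Gamma z / Real.Gamma (1 + z - α)) - 1 := by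
      field_simp
    linarith
  · intro u hu
    have h : 0 < 1 - u := by linarith [hu.2]
    have d1 : HasDerivAt (fun u : ℝ => 1 - u ^ z) (-(z * u ^ (z - 1))) u :=
      (Real.hasDerivAt_rpow_const (Or.inl hu.1.ne')).const_sub 1
    have d2 : HasDerivAt (fun u : ℝ => (1 - u) ^ (-α) - 1) (-1 * (-α) * (1 - u) ^ (-α - 1)) u :=
      (((hasDerivAt_id u).const_sub 1).rpow_const (Or.inl h.ne')).sub_const 1
    exact (d1.mul d2).congr_deriv (by ring)
  · rw [intervalIntegrable_iff_integrableOn_Ioo_of_le zero_le_one]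
    exact hI.sub hJ
  · have c : ContinuousAt (fun u : ℝ => (1 - u ^ z) * ((1 - u) ^ (-α) - 1)) 0 := by
      refine ContinuousAt.mul ?_ ?_
      · exact continuousAt_const.sub (Real.continuousAt_rpow_const _ _ (Or.inr hz.le))
      · exact ((continuousAt_const.sub continuousAt_id).rpow_const (Or.inl (by simp))).sub continuousAt_const
    have := c.tendsto
    simp only [sub_zero, Real.one_rpow, sub_self, mul_zero] at this
    exact this.mono_left nhdsWithin_le_nhds
  · have c : ContinuousAt (fun u : ℝ => (1 + z) * (1 - u) ^ (1 - α)) 1 :=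
      continuousAt_const.mul ((continuousAt_const.sub continuousAt_id).rpow_const (Or.inr (by linarith)))
    have := c.tendsto
    simp only [sub_self, Real.zero_rpow (show 1 - α ≠ 0 by linarith), mul_zero] at this
    have mem : Ioo (0:ℝ) 1 ∈ 𝓝[<] (1:ℝ) := Ioo_mem_nhdsLT zero_lt_one
    refine squeeze_zero' ?_ ?_ (this.mono_left nhdsWithin_le_nhds)
    · filter_upwards [mem] with u hu
      have h : 0 < 1 - u := by linarith [hu.2]
      exact mul_nonneg (ks_bern hz.le hu.1 hu.2).1 (sub_nonneg.2
        (Real.one_le_rpow_of_pos_of_le_one_of_nonpos h (by linarith [hu.1]) (by linarith)))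
    · filter_upwards [mem] with u hu
      have h : 0 < 1 - u := by linarith [hu.2]
      obtain ⟨p1, p2⟩ := ks_bern hz.le hu.1 hu.2
      have e : (1 - u) ^ (1 - α) = (1 - u) * (1 - u) ^ (-α) := by
        rw [mul_comm, ← Real.rpow_add_one h.ne']; congr 1; ring
      have hp := Real.rpow_pos_of_pos h (-α)
      rw [e, ← mul_assoc]
      exact mul_le_mul p2 (by linarith) (sub_nonneg.2
        (Real.one_le_rpow_of_pos_of_le_one_of_nonpos h (by linarith [hu.1]) (by linarith))) (by positivity)

lemma ks_mu {α q z : ℝ} (hα : 0 < α) (hq : 0 < q) (hα1 : α < 1) (hz : 0 ≤ z) :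
    IntegrableOn (fun u : ℝ => (1 - u ^ z) * (u ^ (q - α) * (1 - u) ^ (α - 1))) (Ioo 0 1) ∧
    ∫ u in Ioo (0 : ℝ) 1, (1 - u ^ z) * (u ^ (q - α) * (1 - u) ^ (α - 1)) =
      Real.Gamma α * (Real.Gamma (1 + q - α) / Real.Gamma (1 + q) -
        Real.Gamma (1 + q + z - α) / Real.Gamma (1 + q + z)) := by
  obtain ⟨b1, b2⟩ := ks_beta (u := 1 + q - α) (v := α) (by linarith) hα
  obtain ⟨b3, b4⟩ := ks_beta (u := 1 + q + z - α) (v := α) (by linarith) hα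
  have hEq : EqOn (fun u : ℝ => (1 - u ^ z) * (u ^ (q - α) * (1 - u) ^ (α - 1)))
      (fun u : ℝ => u ^ (1 + q - α - 1) * (1 - u) ^ (α - 1) - u ^ (1 + q + z - α - 1) * (1 - u) ^ (α - 1))
      (Ioo 0 1) := by
    intro u hu
    have e : u ^ (1 + q + z - α - 1) = u ^ z * u ^ (q - α) := by
      rw [← Real.rpow_add hu.1]; congr 1; ring
    have e' : 1 + q - α - 1 = q - α := by ring
    simp only [e, e']
    ring
  refine ⟨(integrableOn_congr_fun hEq measurableSet_Ioo).2 (b1.sub b3), ?_⟩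
  rw [setIntegral_congr_fun measurableSet_Ioo hEq, integral_sub b1 b3, b2, b4]
  simp only [sub_add_cancel]
  ring

lemma ks_ratio {α z : ℝ} (hα : 0 < α) (hα1 : α < 1) (hz : 0 < z) :
    Real.Gamma (1 + z - α) / Real.Gamma (1 + z) ≤ z ^ (-α) := by
  have h := Real.Gamma_mul_add_mul_le_rpow_Gamma_mul_rpow_Gamma (s := z) (t := 1 + z)
    (a := α) (b := 1 - α) hz (by linarith) hα (by linarith) (by ring)
  have g1 : Real.Gamma (1 + z) = z * Real.Gamma z := by
    rw [add_comm, Real.Gamma_add_one hz.ne']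
  have g := Real.Gamma_pos_of_pos hz
  rw [show α * z + (1 - α) * (1 + z) = 1 + z - α by ring, g1, Real.mul_rpow hz.le g.le] at h
  rw [g1, div_le_iff₀ (by positivity)]
  refine h.trans (le_of_eq ?_)
  have e1 : z ^ (1 - α) = z * z ^ (-α) := by
    rw [mul_comm, ← Real.rpow_add_one hz.ne']; congr 1; ring
  have e2 : Real.Gamma z ^ (1 - α) * Real.Gamma z ^ α = Real.Gamma z := by
    rw [← Real.rpow_add g, sub_add_cancel, Real.rpow_one]
  calc _ = z ^ (1 - α) * (Real.Gamma z ^ (1 - α) * Real.Gamma z ^ α) := by ring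
    _ = _ := by rw [e2, e1]; ring

lemma ks_gen {q x : ℝ} (hq : 0 < q) (hx : 0 ≤ x) (b : ℕ → ℝ)
    (hb : ∀ y, Summable fun n => b n * y ^ n) (W : ℝ → ℝ) (hW : ∀ u ∈ Ioo (0:ℝ) 1, 0 ≤ W u)
    (M : ℕ → ℝ) (hi : ∀ n : ℕ, IntegrableOn (fun u : ℝ => (1 - u ^ (q * n)) * W u) (Ioo 0 1))
    (hM : ∀ n : ℕ, ∫ u in Ioo (0:ℝ) 1, (1 - u ^ (q * n)) * W u = M n)
    (hs : Summable fun n => |b n| * x ^ n * M n) :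
    HasSum (fun n => -(b n * (-x) ^ n * M n))
      (∫ u in Ioo (0:ℝ) 1, ((∑' n, b n * (-(x * u ^ q)) ^ n) - ∑' n, b n * (-x) ^ n) * W u) := by
  have h := hasSum_integral_of_summable_integral_norm (μ := volume.restrict (Ioo (0:ℝ) 1))
    (F := fun (n : ℕ) (u : ℝ) => -(b n * (-x) ^ n) * ((1 - u ^ (q * n)) * W u))
    (fun n => (hi n).const_mul _) ?_
  · have h1 : (fun n => -(b n * (-x) ^ n * M n)) = fun n : ℕ => ∫ u in Ioo (0:ℝ) 1,
        -(b n * (-x) ^ n) * ((1 - u ^ (q * n)) * W u) := by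
      funext n
      rw [integral_const_mul, hM]; ring
    rw [h1]
    have h2 : (∫ u in Ioo (0:ℝ) 1, ((∑' n, b n * (-(x * u ^ q)) ^ n) - ∑' n, b n * (-x) ^ n) * W u)
        = ∫ u in Ioo (0:ℝ) 1, ∑' n : ℕ, -(b n * (-x) ^ n) * ((1 - u ^ (q * n)) * W u) := by
      refine setIntegral_congr_fun measurableSet_Ioo fun u hu => ?_
      rw [← (hb _).tsum_sub (hb _), ← tsum_mul_right]
      refine tsum_congr fun n => ?_
      rw [Real.rpow_mul_natCast hu.1.le, ← neg_mul, mul_pow]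
      ring
    rw [h2]
    exact h
  · refine hs.congr fun n => ?_
    rw [← hM, ← integral_const_mul]
    refine setIntegral_congr_fun measurableSet_Ioo fun u hu => ?_
    have h1 := (ks_bern (z := q * n) (by positivity) hu.1 hu.2).1
    simp only [norm_mul, norm_neg, norm_pow, Real.norm_eq_abs, abs_of_nonneg h1,
      abs_of_nonneg (hW u hu), abs_of_nonneg hx]

/-- Weak minimum principle. -/
lemma ks_min {q A : ℝ} (hq : 0 < q) (hA : 0 < A) (B R W : ℝ → ℝ)
    (hW : ∀ u ∈ Ioo (0:ℝ) 1, 0 ≤ W u) (hR : ∀ x, 0 ≤ x → 0 ≤ R x) (hB : Continuous B)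
    (h : ∀ x, 0 ≤ x → B x * (1 + A * x) = R x + ∫ u in Ioo (0:ℝ) 1, (B (x * u ^ q) - B x) * W u)
    (x : ℝ) (hx : 0 ≤ x) : 0 ≤ B x := by
  by_contra! hneg
  obtain ⟨y, hy, hmin⟩ := isCompact_Icc.exists_isMinOn (nonempty_Icc.2 hx) hB.continuousOn
  have hy1 : B y < 0 := (hmin (right_mem_Icc.2 hx)).trans_lt hneg
  have h1 := h y hy.1
  have h2 : 0 ≤ ∫ u in Ioo (0:ℝ) 1, (B (y * u ^ q) - B y) * W u := by
    refine setIntegral_nonneg measurableSet_Ioo fun u hu => mul_nonneg (sub_nonneg.2 (hmin ?_)) (hW u hu)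
    have p0 := Real.rpow_nonneg hu.1.le q
    have p1 := Real.rpow_le_one hu.1.le hu.2.le hq.le
    exact ⟨mul_nonneg hy.1 p0, (mul_le_of_le_one_right hy.1 p1).trans hy.2⟩
  have h3 := hR y hy.1
  have : 0 < 1 + A * y := by have := mul_nonneg hA.le hy.1; linarith
  nlinarith

lemma ks_cont (b : ℕ → ℝ) (hb : ∀ y, Summable fun n => b n * y ^ n) :
    Continuous fun y : ℝ => ∑' n, b n * (-y) ^ n := by
  rw [continuous_iff_continuousAt]
  intro y
  have : ContinuousOn (fun y : ℝ => ∑' n, b n * (-y) ^ n) (Icc (-(|y| + 1)) (|y| + 1)) := by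
    refine continuousOn_tsum (fun n => by fun_prop) (hb (|y| + 1)).norm fun n z hz => ?_
    simp only [norm_mul, norm_pow, norm_neg, Real.norm_eq_abs]
    have hz' : |z| ≤ abs (|y| + 1) := (abs_le.2 hz).trans (le_abs_self _)
    exact mul_le_mul_of_nonneg_left (pow_le_pow_left₀ (abs_nonneg z) hz' n) (abs_nonneg _)
  refine this.continuousAt (Icc_mem_nhds ?_ ?_)
  · linarith [neg_abs_le y]
  · linarith [le_abs_self y]

lemma ks_rho_pos {α q : ℝ} (hα1 : α < 1) (hq : 0 < q) (n : ℕ) :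
    0 < Real.Gamma (1 + q * (n + 1) - α) / Real.Gamma (1 + q * (n + 1)) := by
  have : 0 < q * (n + 1) := by positivity
  exact div_pos (Real.Gamma_pos_of_pos (by linarith)) (Real.Gamma_pos_of_pos (by linarith))

lemma ks_c_pos {α q : ℝ} (hα1 : α < 1) (hq : 0 < q) (c : ℕ → ℝ)
    (hc0 : c 0 = 1) (hc : ∀ n : ℕ, c (n + 1) = c n *
      (Real.Gamma (1 + q * (n + 1) - α) / Real.Gamma (1 + q * (n + 1)))) (n : ℕ) : 0 < c n := by
  induction n with
  | zero => simp [hc0]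
  | succ n ih => rw [hc]; exact mul_pos ih (ks_rho_pos hα1 hq n)

lemma ks_c_summable {α q : ℝ} (hα : 0 < α) (hα1 : α < 1) (hq : 0 < q) (c : ℕ → ℝ)
    (hc0 : c 0 = 1) (hc : ∀ n : ℕ, c (n + 1) = c n *
      (Real.Gamma (1 + q * (n + 1) - α) / Real.Gamma (1 + q * (n + 1)))) (y : ℝ) : Summable fun n => c n * y ^ n := by
  rcases eq_or_ne y 0 with rfl | hy
  · exact summable_of_ne_finset_zero (s := {0}) fun n hn => by
      simp at hn; simp [hn]
  refine summable_of_ratio_test_tendsto_lt_one zero_lt_one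
    (Eventually.of_forall fun n => mul_ne_zero (ks_c_pos hα1 hq c hc0 hc n).ne' (pow_ne_zero n hy)) ?_
  have lim : Tendsto (fun n : ℕ => (q * ((n : ℝ) + 1)) ^ (-α) * |y|) atTop (𝓝 0) := by
    have h1 : Tendsto (fun n : ℕ => q * ((n : ℝ) + 1)) atTop atTop :=
      (tendsto_atTop_add_const_right _ _ tendsto_natCast_atTop_atTop).const_mul_atTop hq
    simpa using ((tendsto_rpow_neg_atTop hα).comp h1).mul_const |y|
  refine squeeze_zero (fun n => by positivity) (fun n => ?_) lim
  have p := ks_c_pos hα1 hq c hc0 hc n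
  have p2 := ks_rho_pos hα1 hq n
  have hy' : 0 < |y| := abs_pos.2 hy
  have := ks_ratio hα hα1 (z := q * (n + 1)) (by positivity)
  rw [hc]
  simp only [norm_mul, norm_pow, Real.norm_eq_abs, abs_of_pos p, abs_of_pos p2]
  rw [div_le_iff₀ (by positivity), pow_succ]
  have := mul_le_mul_of_nonneg_right this (show 0 ≤ c n * |y| ^ n * |y| by positivity)
  linarith

lemma ks_core {α q : ℝ} (hα : 0 < α) (hα1 : α < 1) (hq : 0 < q) (c : ℕ → ℝ)
    (hc0 : c 0 = 1) (hc : ∀ n : ℕ, c (n + 1) = c n *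
      (Real.Gamma (1 + q * (n + 1) - α) / Real.Gamma (1 + q * (n + 1)))) (e : ℕ → ℝ)
    (he : ∀ n, |e n| ≤ 1) :
    (∀ y, Summable fun n => c n * e n * y ^ n) ∧ ∀ x : ℝ, 0 ≤ x →
    ∫ u in Ioo (0:ℝ) 1, ((∑' n, c n * e n * (-(x * u ^ q)) ^ n) - ∑' n, c n * e n * (-x) ^ n) *
        (α * (1 - u) ^ (-α - 1)) =
      (∑' n, c n * e n * (-x) ^ n) - e 0 +
        Real.Gamma (1 - α) * x * ∑' n, c n * e (n + 1) * (-x) ^ n := by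
  have cp := ks_c_pos hα1 hq c hc0 hc
  have cs := ks_c_summable hα hα1 hq c hc0 hc
  have sm : ∀ e : ℕ → ℝ, (∀ n, |e n| ≤ 1) → ∀ y, Summable fun n => c n * e n * y ^ n := by
    intro e he y
    refine Summable.of_norm_bounded (cs y).norm fun n => ?_
    simp only [norm_mul, Real.norm_eq_abs]
    have := mul_le_mul_of_nonneg_left (he n) (abs_nonneg (c n))
    rw [mul_one] at this
    exact mul_le_mul_of_nonneg_right this (by positivity)
  refine ⟨sm e he, fun x hx => ?_⟩
  set A := Real.Gamma (1 - α) with hA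
  have Apos : 0 < A := Real.Gamma_pos_of_pos (by linarith)
  set M : ℕ → ℝ := fun n => A * (Real.Gamma (1 + q * n) / Real.Gamma (1 + q * n - α)) - 1 with hM
  have M0 : M 0 = 0 := by
    simp [hM, ← hA, Apos.ne']
  have Ms : ∀ n, c (n + 1) * (M (n + 1) + 1) = A * c n := by
    intro n
    have h0 : 0 < q * ((n:ℝ) + 1) := by positivity
    have g1 := Real.Gamma_pos_of_pos (show 0 < 1 + q * ((n:ℝ) + 1) by linarith)
    have g2 := Real.Gamma_pos_of_pos (show 0 < 1 + q * ((n:ℝ) + 1) - α by linarith)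
    rw [hc]
    simp only [hM]
    push_cast
    field_simp
    ring
  have T : ∀ e : ℕ → ℝ, (∀ n, |e n| ≤ 1) → ∀ y : ℝ,
      HasSum (fun n => c n * e n * y ^ n * (M n + 1))
        (A * y * (∑' n, c n * e (n + 1) * y ^ n) + e 0) := by
    intro e he y
    have h := (sm (fun n => e (n + 1)) (fun n => he _) y).hasSum.mul_left (A * y)
    rw [← hasSum_nat_add_iff' 1]
    simp only [Finset.range_one, Finset.sum_singleton, M0, hc0]
    rw [show A * y * (∑' n, c n * e (n + 1) * y ^ n) + e 0 - 1 * e 0 * y ^ 0 * (0 + 1) =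
      A * y * (∑' n, c n * e (n + 1) * y ^ n) by ring]
    refine h.congr_fun fun n => ?_
    calc _ = c (n + 1) * (M (n + 1) + 1) * (e (n + 1) * y ^ (n + 1)) := by ring
      _ = _ := by rw [Ms]; ring
  have nu := fun n : ℕ => ks_nu (z := q * n) hα hα1 (by positivity)
  have G := ks_gen hq hx (fun n => c n * e n) (sm e he) (fun u => α * (1 - u) ^ (-α - 1))
    (fun u hu => by
      have : 0 < 1 - u := by linarith [hu.2]
      positivity) M (fun n => (nu n).1) (fun n => (nu n).2) ?_
  · have h2 := ((sm e he (-x)).hasSum.sub (T e he (-x)))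
    have := G.unique (h2.congr_fun fun n => by ring)
    rw [this]
    ring
  · have h := (T (fun n => |e n|) (by simpa using he) x).summable.sub
      (sm (fun n => |e n|) (by simpa using he) x)
    refine h.congr fun n => ?_
    rw [abs_mul, abs_of_pos (cp n)]
    ring

lemma ks_main {α q : ℝ} (hα : 0 < α) (hα1 : α < 1) (hq : 0 < q) (c : ℕ → ℝ)
    (hc0 : c 0 = 1) (hc : ∀ n : ℕ, c (n + 1) = c n *
      (Real.Gamma (1 + q * (n + 1) - α) / Real.Gamma (1 + q * (n + 1)))) (x : ℝ)
    (hx : 0 ≤ x) :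
    1 / (1 + Real.Gamma (1 - α) * x) ≤ ∑' n, c n * (-x) ^ n ∧
    ∑' n, c n * (-x) ^ n ≤ 1 / (1 + Real.Gamma (1 + q - α) / Real.Gamma (1 + q) * x) := by
  have cp := ks_c_pos hα1 hq c hc0 hc
  have cs := ks_c_summable hα hα1 hq c hc0 hc
  set A := Real.Gamma (1 - α) with hA
  have Apos : 0 < A := Real.Gamma_pos_of_pos (by linarith)
  set g : ℝ → ℝ := fun y => ∑' n, c n * (-y) ^ n with hg
  have hW : ∀ u ∈ Ioo (0:ℝ) 1, 0 ≤ α * (1 - u) ^ (-α - 1) := fun u hu => by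
    have : 0 < 1 - u := by linarith [hu.2]
    positivity
  -- the equation for g
  have eqg : ∀ x, 0 ≤ x → g x * (1 + A * x) =
      1 + ∫ u in Ioo (0:ℝ) 1, (g (x * u ^ q) - g x) * (α * (1 - u) ^ (-α - 1)) := by
    intro x hx
    have h := (ks_core hα hα1 hq c hc0 hc (fun _ => 1) (by simp)).2 x hx
    simp only [mul_one] at h
    simp only [hg]
    rw [h]
    ring
  have gnn : ∀ x, 0 ≤ x → 0 ≤ g x :=
    ks_min hq Apos g (fun _ => 1) _ hW (by simp) (ks_cont c cs) eqg
  -- monotonicity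
  have mono : ∀ κ : ℝ, 0 ≤ κ → κ ≤ 1 → ∀ x, 0 ≤ x → g x ≤ g (x * κ) := by
    intro κ h0 h1
    have he : ∀ n : ℕ, |κ ^ n - 1| ≤ 1 := by
      intro n
      have := pow_nonneg h0 n
      have := pow_le_one₀ (n := n) h0 h1
      rw [abs_le]; constructor <;> linarith
    obtain ⟨s, h⟩ := ks_core hα hα1 hq c hc0 hc (fun n => κ ^ n - 1) he
    have D1 : ∀ y, ∑' n, c n * (κ ^ n - 1) * (-y) ^ n = g (y * κ) - g y := by
      intro y
      simp only [hg]
      rw [← (cs _).tsum_sub (cs _)]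
      refine tsum_congr fun n => ?_
      rw [← neg_mul, mul_pow]; ring
    have D2 : ∀ y, ∑' n, c n * (κ ^ (n + 1) - 1) * (-y) ^ n = κ * g (y * κ) - g y := by
      intro y
      simp only [hg]
      rw [← tsum_mul_left, ← ((cs _).mul_left κ).tsum_sub (cs _)]
      refine tsum_congr fun n => ?_
      rw [← neg_mul, mul_pow]; ring
    have ct := ks_cont _ s
    simp only [D1] at ct
    intro x hx
    refine sub_nonneg.1 (ks_min hq Apos (fun y => g (y * κ) - g y)
      (fun y => A * y * (1 - κ) * g (y * κ)) _ hW ?_ ct ?_ x hx)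
    · intro y hy
      have := gnn (y * κ) (mul_nonneg hy h0)
      have : 0 ≤ 1 - κ := by linarith
      positivity
    · intro y hy
      have h' := h y hy
      simp only [D1, D2] at h'
      rw [h']
      ring
  have mono' : ∀ u ∈ Ioo (0:ℝ) 1, 0 ≤ g (x * u ^ q) - g x := fun u hu =>
    sub_nonneg.2 (mono (u ^ q) (Real.rpow_nonneg hu.1.le q)
      (Real.rpow_le_one hu.1.le hu.2.le hq.le) x hx)
  constructor
  · rw [div_le_iff₀ (by positivity)]
    change 1 ≤ g x * _
    rw [eqg x hx]
    have := setIntegral_nonneg measurableSet_Ioo (μ := volume)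
      fun u hu => mul_nonneg (mono' u hu) (hW u hu)
    linarith
  · set r := Real.Gamma (1 + q - α) / Real.Gamma (1 + q) with hr
    have rp : 0 < r := div_pos (Real.Gamma_pos_of_pos (by linarith)) (Real.Gamma_pos_of_pos (by linarith))
    rw [le_div_iff₀ (by positivity)]
    change g x * _ ≤ 1
    have mu := fun n : ℕ => ks_mu (q := q) (z := q * n) hα hq hα1 (by positivity)
    have hW' : ∀ u ∈ Ioo (0:ℝ) 1, 0 ≤ u ^ (q - α) * (1 - u) ^ (α - 1) := fun u hu => by
      have : 0 < 1 - u := by linarith [hu.2]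
      have := hu.1
      positivity
    set N : ℕ → ℝ := fun n => Real.Gamma α * (r -
        Real.Gamma (1 + q + q * n - α) / Real.Gamma (1 + q + q * n)) with hN
    have Ga := Real.Gamma_pos_of_pos hα
    have cN : ∀ n, c n * N n = Real.Gamma α * (r * c n - c (n + 1)) := by
      intro n
      rw [hc]
      simp only [hN]
      rw [show 1 + q * ((n:ℝ) + 1) = 1 + q + q * n by ring]
      ring
    have sN : ∀ y, HasSum (fun n => c n * y ^ n * N n * y)
        (Real.Gamma α * (r * y * (∑' n, c n * y ^ n) - (∑' n, c n * y ^ n - 1))) := by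
      intro y
      have h1 := (hasSum_nat_add_iff' 1).2 (cs y).hasSum
      simp only [Finset.range_one, Finset.sum_singleton, hc0, pow_zero, mul_one] at h1
      have h2 := (((cs y).hasSum.mul_left (r * y)).sub h1).mul_left (Real.Gamma α)
      refine h2.congr_fun fun n => ?_
      calc _ = c n * N n * (y ^ n * y) := by ring
        _ = _ := by rw [cN]; ring
    rcases hx.eq_or_lt with rfl | hxp
    · have : g 0 = 1 := by
        simp only [hg]
        rw [tsum_eq_single 0 (fun n hn => by simp [hn])]
        simp [hc0]
      simp [this]
    have G := ks_gen hq hx c cs (fun u => u ^ (q - α) * (1 - u) ^ (α - 1)) hW' N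
      (fun n => (mu n).1) (fun n => (mu n).2) ?_
    · have h3 := sN (-x)
      have h4 := (G.mul_right x).unique (h3.congr_fun fun n => by ring)
      have h5 : 0 ≤ ∫ u in Ioo (0:ℝ) 1, (g (x * u ^ q) - g x) * (u ^ (q - α) * (1 - u) ^ (α - 1)) :=
        setIntegral_nonneg measurableSet_Ioo fun u hu => mul_nonneg (mono' u hu) (hW' u hu)
      have h6 := mul_nonneg h5 hx
      simp only [hg] at h6 ⊢
      rw [h4] at h6
      have h7 := nonneg_of_mul_nonneg_right h6 Ga
      linarith
    · refine ((sN x).summable.mul_right x⁻¹).congr fun n => ?_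
      rw [abs_of_pos (cp n)]
      field_simp

theorem kilbasSaigo_hyperbolic_bounds (α m x : ℝ)
    (hα : α ∈ Set.Ioo (0 : ℝ) 1) (hm : 0 < m) (hx : 0 ≤ x) :
    1 / (1 + Real.Gamma (1 - α) * x) ≤ kilbasSaigo α m (m - 1) (-x) ∧
    kilbasSaigo α m (m - 1) (-x) ≤
      1 / (1 + Real.Gamma (1 + α * (m - 1)) / Real.Gamma (1 + α * m) * x) := by
  obtain ⟨h0, h1⟩ := hα
  have hq : 0 < α * m := mul_pos h0 hm
  have h := ks_main h0 h1 hq (fun n : ℕ => ∏ k ∈ Finset.range n,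
    Real.Gamma (1 + α * (k * m + (m - 1))) / Real.Gamma (1 + α * (k * m + (m - 1) + 1)))
    (by simp) (fun n => ?_) x hx
  · rw [show 1 + α * (m - 1) = 1 + α * m - α by ring]
    exact h
  · simp only [Finset.prod_range_succ]
    congr 3 <;> ring
end

section
/- For every α ∈ (0,1), m > 0 and x ≥ 0 such that Γ(1−α) x < 1, one has E_{α,m,m−1}(x) ≤ 1/(1 − Γ(1−α) x). -/
theorem gamma_ratio_le (α t : ℝ) (h0 : 0 < α) (h1 : α < 1) (ht : 0 < t) :
    Real.Gamma (1 - α + t) / Real.Gamma (1 + t) ≤ Real.Gamma (1 - α) := by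
  have hs : 0 < 1 - α := by linarith
  have hu : 0 < 1 + t := by linarith
  have hst : 0 < α + t := by linarith
  have gs := Real.Gamma_pos_of_pos hs
  have gu := Real.Gamma_pos_of_pos hu
  have ha : 0 < α / (α + t) := by positivity
  have hb : 0 < t / (α + t) := by positivity
  have hab : α / (α + t) + t / (α + t) = 1 := by field_simp
  have e1 := Real.Gamma_mul_add_mul_le_rpow_Gamma_mul_rpow_Gamma hs hu ha hb hab
  have e2 := Real.Gamma_mul_add_mul_le_rpow_Gamma_mul_rpow_Gamma hs hu hb ha
    (by rw [add_comm]; exact hab)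
  have q1 : α / (α + t) * (1 - α) + t / (α + t) * (1 + t) = 1 - α + t := by
    field_simp; ring
  have q2 : t / (α + t) * (1 - α) + α / (α + t) * (1 + t) = 1 := by
    field_simp; ring
  rw [q1] at e1
  rw [q2, Real.Gamma_one] at e2
  rw [div_le_iff₀ gu]
  have g1 : 0 < Real.Gamma (1 - α + t) := Real.Gamma_pos_of_pos (by linarith)
  have key := mul_le_mul e1 e2 zero_le_one (by positivity)
  rw [mul_one] at key
  refine key.trans (le_of_eq ?_)
  rw [mul_mul_mul_comm, ← Real.rpow_add gs, ← Real.rpow_add gu, hab,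
    add_comm (t / (α + t)), hab, Real.rpow_one, Real.rpow_one]

theorem kilbasSaigo_upper_bound_positive (α m x : ℝ)
    (hα : α ∈ Set.Ioo (0 : ℝ) 1) (hm : 0 < m) (hx : 0 ≤ x)
    (hx1 : Real.Gamma (1 - α) * x < 1) :
    kilbasSaigo α m (m - 1) x ≤ 1 / (1 - Real.Gamma (1 - α) * x) := by
  obtain ⟨h0, h1⟩ := hα
  have hG : 0 < Real.Gamma (1 - α) := Real.Gamma_pos_of_pos (by linarith)
  have hGx : 0 ≤ Real.Gamma (1 - α) * x := by positivity
  have hf (k : ℕ) : 0 ≤ Real.Gamma (1 + α * (k * m + (m - 1))) /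
        Real.Gamma (1 + α * (k * m + (m - 1) + 1)) ∧
      Real.Gamma (1 + α * (k * m + (m - 1))) / Real.Gamma (1 + α * (k * m + (m - 1) + 1))
        ≤ Real.Gamma (1 - α) := by
    have ht : 0 < α * ((k + 1) * m) := by positivity
    have e1 : 1 + α * (k * m + (m - 1)) = 1 - α + α * ((k + 1) * m) := by ring
    have e2 : 1 + α * (k * m + (m - 1) + 1) = 1 + α * ((k + 1) * m) := by ring
    rw [e1, e2]
    refine ⟨?_, gamma_ratio_le α _ h0 h1 ht⟩
    exact div_nonneg (Real.Gamma_pos_of_pos (by linarith)).le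
      (Real.Gamma_pos_of_pos (by linarith)).le
  have hle (n : ℕ) : (∏ k ∈ Finset.range n, Real.Gamma (1 + α * (k * m + (m - 1))) /
      Real.Gamma (1 + α * (k * m + (m - 1) + 1))) * x ^ n ≤ (Real.Gamma (1 - α) * x) ^ n := by
    rw [mul_pow]
    refine mul_le_mul_of_nonneg_right ?_ (by positivity)
    refine (Finset.prod_le_prod (fun k _ => (hf k).1) (fun k _ => (hf k).2)).trans ?_
    simp
  have hnn (n : ℕ) : 0 ≤ (∏ k ∈ Finset.range n, Real.Gamma (1 + α * (k * m + (m - 1))) /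
      Real.Gamma (1 + α * (k * m + (m - 1) + 1))) * x ^ n :=
    mul_nonneg (Finset.prod_nonneg fun k _ => (hf k).1) (by positivity)
  have hg := summable_geometric_of_lt_one hGx hx1
  rw [one_div, ← tsum_geometric_of_lt_one hGx hx1]
  unfold kilbasSaigo
  exact (Summable.of_nonneg_of_le hnn hle hg).tsum_le_tsum hle hg
end

section
/- Fix α ∈ (0,1] and x ∈ ℝ, x ≠ 0. The functions m ↦ E_{α,m,m−1}(x) and m ↦ E_{α,m,m−1/α}(x) are strictly decreasing on (0,∞) if x > 0 and strictly increasing on (0,∞) if x < 0; that is, for all 0 < m₁ < m₂: if x > 0 then E_{α,m₂,m₂−1}(x) < E_{α,m₁,m₁−1}(x) and E_{α,m₂,m₂−1/α}(x) < E_{α,m₁,m₁−1/α}(x), while if x < 0 the reverse strict inequalities hold. -/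
open MeasureTheory Set Filter Topology

/-- Abstract data: `r p = κ + ∫ (1 - u^p) w u du`. -/
structure KSData (w r : ℝ → ℝ) (κ : ℝ) : Prop where
  wpos : ∀ u ∈ Ioo (0:ℝ) 1, 0 < w u
  wcont : ContinuousOn w (Ioo 0 1)
  kap : 0 ≤ κ
  int : ∀ p : ℝ, 0 < p → IntegrableOn (fun u => (1 - u ^ p) * w u) (Ioo 0 1)
  eq : ∀ p : ℝ, 0 < p → r p = κ + ∫ u in Ioo (0:ℝ) 1, (1 - u ^ p) * w u
  top : Tendsto r atTop atTop

noncomputable def ksC (r : ℝ → ℝ) (b x : ℝ) (n : ℕ) : ℝ :=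
  (∏ k ∈ Finset.range n, 1 / r (b * (k + 1))) * x ^ n

noncomputable def ksF (r : ℝ → ℝ) (b x t : ℝ) : ℝ := ∑' n, ksC r b x n * t ^ (b * n)

lemma integral_pos_of_pos {f : ℝ → ℝ} (hf : ∀ u ∈ Ioo (0:ℝ) 1, 0 < f u)
    (hi : IntegrableOn f (Ioo 0 1)) : 0 < ∫ u in Ioo (0:ℝ) 1, f u := by
  rw [setIntegral_pos_iff_support_of_nonneg_ae]
  · have : Function.support f ∩ Ioo 0 1 = Ioo 0 1 := by
      rw [inter_eq_right]
      intro u hu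
      exact (hf u hu).ne'
    rw [this]; simp
  · filter_upwards [ae_restrict_mem measurableSet_Ioo] with u hu using (hf u hu).le
  · exact hi

namespace KSData
variable {w r : ℝ → ℝ} {κ : ℝ} (D : KSData w r κ)

lemma rpos' {w r : ℝ → ℝ} {κ : ℝ} (D : KSData w r κ) {p : ℝ} (hp : 0 < p) : 0 < r p := by
  rw [D.eq p hp]
  refine add_pos_of_nonneg_of_pos D.kap (integral_pos_of_pos (fun u hu => ?_) (D.int p hp))
  exact mul_pos (by have := Real.rpow_lt_one hu.1.le hu.2 hp; linarith) (D.wpos u hu)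

lemma rmono {w r : ℝ → ℝ} {κ : ℝ} (D : KSData w r κ) {p q : ℝ} (hp : 0 < p) (hpq : p < q) :
    r p < r q := by
  rw [D.eq p hp, D.eq q (hp.trans hpq)]
  have := integral_pos_of_pos (f := fun u => (1 - u ^ q) * w u - (1 - u ^ p) * w u)
    (fun u hu => ?_) ((D.int q (hp.trans hpq)).sub (D.int p hp))
  · rw [integral_sub (D.int q (hp.trans hpq)) (D.int p hp)] at this
    linarith
  · have h1 := Real.rpow_lt_rpow_of_exponent_gt hu.1 hu.2 hpq
    have h2 := D.wpos u hu
    nlinarith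

lemma csucc {r : ℝ → ℝ} (b x : ℝ) (n : ℕ) :
    ksC r b x (n+1) = ksC r b x n * (x / r (b * (n+1))) := by
  unfold ksC
  rw [Finset.prod_range_succ, pow_succ]; ring

lemma csucc' {w r : ℝ → ℝ} {κ : ℝ} (D : KSData w r κ) {b : ℝ} (hb : 0 < b) (x : ℝ) (n : ℕ) :
    ksC r b x (n+1) * r (b * (n+1)) = ksC r b x n * x := by
  rw [csucc]
  have := D.rpos' (p := b * (n+1)) (by positivity)
  field_simp

lemma csum' {w r : ℝ → ℝ} {κ : ℝ} (D : KSData w r κ) {b : ℝ} (hb : 0 < b) (x : ℝ) :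
    Summable (fun n => |ksC r b x n|) := by
  have h1 : Tendsto (fun n : ℕ => r (b * (n+1))) atTop atTop := by
    refine D.top.comp (Tendsto.const_mul_atTop hb ?_)
    exact tendsto_atTop_add_const_right _ _ tendsto_natCast_atTop_atTop
  have h2 : ∀ᶠ n : ℕ in atTop, 2 * |x| ≤ r (b * (n+1)) := h1.eventually_ge_atTop _
  refine summable_of_ratio_norm_eventually_le (r := 1/2) (by norm_num) ?_
  filter_upwards [h2] with n hn
  have h3 := D.rpos' (p := b * (n+1)) (by positivity)
  rw [csucc, Real.norm_eq_abs, Real.norm_eq_abs, abs_abs, abs_abs, abs_mul, abs_div, abs_of_pos h3,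
    mul_comm]
  refine mul_le_mul_of_nonneg_right ?_ (abs_nonneg _)
  rw [div_le_iff₀ h3]; linarith

lemma termbound {r : ℝ → ℝ} {b : ℝ} (hb : 0 < b) (x : ℝ) (n : ℕ) {t : ℝ} (ht : t ∈ Icc (0:ℝ) 1) :
    ‖ksC r b x n * t ^ (b * n)‖ ≤ |ksC r b x n| := by
  rw [norm_mul, Real.norm_eq_abs, Real.norm_eq_abs, abs_of_nonneg (Real.rpow_nonneg ht.1 _)]
  exact mul_le_of_le_one_right (abs_nonneg _) (Real.rpow_le_one ht.1 ht.2 (by positivity))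

lemma Fsum {w r : ℝ → ℝ} {κ : ℝ} (D : KSData w r κ) {b : ℝ} (hb : 0 < b) (x : ℝ)
    {t : ℝ} (ht : t ∈ Icc (0:ℝ) 1) : Summable (fun n : ℕ => ksC r b x n * t ^ (b * n)) :=
  Summable.of_norm_bounded (D.csum' hb x) (fun n => termbound hb x n ht)

lemma Fcont {w r : ℝ → ℝ} {κ : ℝ} (D : KSData w r κ) {b : ℝ} (hb : 0 < b) (x : ℝ) :
    ContinuousOn (ksF r b x) (Icc 0 1) := by
  unfold ksF
  refine continuousOn_tsum (u := fun n => |ksC r b x n|) (fun n => ?_) (D.csum' hb x)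
    (fun n t ht => termbound hb x n ht)
  refine continuousOn_const.mul (Continuous.continuousOn ?_)
  exact Real.continuous_rpow_const (by positivity)

lemma F0 {r : ℝ → ℝ} {b : ℝ} (hb : 0 < b) (x : ℝ) : ksF r b x 0 = 1 := by
  unfold ksF
  rw [tsum_eq_single 0]
  · simp [ksC]
  · intro n hn
    have : (0:ℝ) < n := by exact_mod_cast Nat.pos_of_ne_zero hn
    rw [Real.zero_rpow (by positivity), mul_zero]

lemma op {w r : ℝ → ℝ} {κ : ℝ} (D : KSData w r κ) {b : ℝ} (hb : 0 < b) (x : ℝ)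
    {t : ℝ} (ht : t ∈ Ioc (0:ℝ) 1) :
    IntegrableOn (fun u => (ksF r b x t - ksF r b x (t * u)) * w u) (Ioo 0 1) ∧
    ∫ u in Ioo (0:ℝ) 1, (ksF r b x t - ksF r b x (t * u)) * w u
      = κ * (1 - ksF r b x t) + x * t ^ b * ksF r b x t := by
  have ht' : t ∈ Icc (0:ℝ) 1 := ⟨ht.1.le, ht.2⟩
  set c := ksC r b x with hc
  set f : ℕ → ℝ → ℝ := fun n u => c n * t ^ (b * n) * ((1 - u ^ (b * n)) * w u) with hf
  have hmem : ∀ u ∈ Ioo (0:ℝ) 1, t * u ∈ Icc (0:ℝ) 1 := fun u hu =>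
    ⟨by nlinarith [hu.1, ht.1], by nlinarith [hu.1, ht.1, hu.2, ht.2]⟩
  have hbn : ∀ n : ℕ, 0 < b * ((n + 1 : ℕ) : ℝ) := fun n => by positivity
  have fint : ∀ n, IntegrableOn (f n) (Ioo 0 1) := by
    intro n
    rcases n with _ | n
    · simp [hf]
    · exact (D.int _ (hbn n)).const_mul _
  have fval : ∀ n : ℕ, ∫ u in Ioo (0:ℝ) 1, f (n+1) u
      = c (n+1) * t ^ (b * (n+1 : ℕ)) * (r (b * (n+1 : ℕ)) - κ) := by
    intro n
    rw [integral_const_mul, D.eq _ (hbn n)]; ring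
  have fval0 : ∫ u in Ioo (0:ℝ) 1, f 0 u = 0 := by simp [hf]
  have fnorm : ∀ n : ℕ, ∫ u in Ioo (0:ℝ) 1, ‖f (n+1) u‖
      = |c (n+1)| * t ^ (b * (n+1 : ℕ)) * (r (b * (n+1 : ℕ)) - κ) := by
    intro n
    rw [D.eq _ (hbn n), add_sub_cancel_left, ← integral_const_mul]
    refine setIntegral_congr_fun measurableSet_Ioo (fun u hu => ?_)
    have h1 := (Real.rpow_lt_one hu.1.le hu.2 (hbn n))
    have h2 := D.wpos u hu
    simp only [hf]
    rw [norm_mul, norm_mul, Real.norm_eq_abs, Real.norm_eq_abs, Real.norm_eq_abs,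
      abs_of_nonneg (Real.rpow_nonneg ht.1.le _), abs_of_pos (mul_pos (sub_pos.2 h1) h2)]
  have cs := D.csum' hb x
  have fsum : Summable (fun n => ∫ u in Ioo (0:ℝ) 1, ‖f n u‖) := by
    rw [← summable_nat_add_iff 1]
    refine Summable.of_nonneg_of_le (fun n => integral_nonneg fun u => norm_nonneg _) (fun n => ?_)
      (cs.mul_right |x|)
    rw [fnorm]
    have h3 := D.csucc' hb x n
    have h4 : |c (n+1)| * r (b * (n+1)) = |c n| * |x| := by
      have h5 := D.rpos' (p := b * (n+1)) (by positivity)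
      rw [← abs_mul, ← h3, abs_mul, abs_of_pos h5]
    rw [← h4]
    have h6 : t ^ (b * (n+1 : ℕ)) ≤ 1 := Real.rpow_le_one ht.1.le ht.2 (hbn n).le
    have h7 : 0 ≤ t ^ (b * (n+1 : ℕ)) := Real.rpow_nonneg ht.1.le _
    have h8 := D.rpos' (hbn n)
    have h9 := D.kap
    have h10 : t ^ (b * (n+1 : ℕ)) * (r (b * (n+1 : ℕ)) - κ) ≤ r (b * (n+1 : ℕ)) := by
      nlinarith [mul_nonneg h7 h9]
    rw [mul_assoc]
    push_cast at h10 ⊢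
    exact mul_le_mul_of_nonneg_left h10 (abs_nonneg _)
  have ftsum : ∀ u ∈ Ioo (0:ℝ) 1, ∑' n, f n u = (ksF r b x t - ksF r b x (t * u)) * w u := by
    intro u hu
    unfold ksF
    rw [← (D.Fsum hb x ht').tsum_sub (D.Fsum hb x (hmem u hu)), ← tsum_mul_right]
    refine tsum_congr fun n => ?_
    rw [Real.mul_rpow ht.1.le hu.1.le]
    simp only [hf, hc]; ring
  have hs := hasSum_integral_of_summable_integral_norm fint fsum
  constructor
  · refine ⟨?_, ?_⟩
    · refine ContinuousOn.aestronglyMeasurable ?_ measurableSet_Ioo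
      refine ContinuousOn.mul (continuousOn_const.sub ?_) D.wcont
      exact (D.Fcont hb x).comp (by fun_prop) hmem
    · refine lt_of_le_of_lt (b := ∑' n, ∫⁻ u in Ioo (0:ℝ) 1, ‖f n u‖ₑ) ?_ ?_
      · rw [← lintegral_tsum (fun n => (fint n).1.enorm)]
        refine setLIntegral_mono_ae' measurableSet_Ioo (ae_of_all _ fun u hu => ?_)
        beta_reduce
        rw [← ftsum u hu]
        exact enorm_tsum_le_tsum_enorm
      · have : ∀ n, ∫⁻ u in Ioo (0:ℝ) 1, ‖f n u‖ₑ = ENNReal.ofReal (∫ u in Ioo (0:ℝ) 1, ‖f n u‖) :=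
          fun n => (ofReal_integral_norm_eq_lintegral_enorm (fint n)).symm
        simp_rw [this]
        exact lt_top_iff_ne_top.2 fsum.tsum_ofReal_ne_top
  · rw [← setIntegral_congr_fun measurableSet_Ioo ftsum, ← hs.tsum_eq, hs.summable.tsum_eq_zero_add,
      fval0, zero_add]
    simp_rw [fval]
    have hF := D.Fsum hb x ht'
    have e1 : ksF r b x t = 1 + ∑' n : ℕ, c (n+1) * t ^ (b * (n+1 : ℕ)) := by
      unfold ksF
      rw [hF.tsum_eq_zero_add]
      simp [ksC, hc]
    have e2 : ∀ n : ℕ, c (n+1) * t ^ (b * (n+1 : ℕ)) * (r (b * (n+1 : ℕ)) - κ)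
      = x * t ^ b * (c n * t ^ (b * n)) - κ * (c (n+1) * t ^ (b * (n+1 : ℕ))) := by
      intro n
      have h3 := D.csucc' hb x n
      have h4 : t ^ (b * (n+1 : ℕ)) = t ^ (b * n) * t ^ b := by
        rw [← Real.rpow_add ht.1]; push_cast; ring_nf
      rw [h4]; push_cast
      linear_combination (t ^ (b * n) * t ^ b) * h3
    simp_rw [e2]
    rw [Summable.tsum_sub (hF.mul_left _) (((summable_nat_add_iff 1).2 hF).mul_left _),
      tsum_mul_left, tsum_mul_left]
    have e3 : ∑' n : ℕ, c (n+1) * t ^ (b * (n+1 : ℕ)) = ksF r b x t - 1 := by rw [e1]; ring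
    rw [e3]; simp only [ksF]; ring

lemma Fnonneg {w r : ℝ → ℝ} {κ : ℝ} (D : KSData w r κ) {b : ℝ} (hb : 0 < b) {x : ℝ} (hx : x < 0)
    {t : ℝ} (ht : t ∈ Icc (0:ℝ) 1) : 0 ≤ ksF r b x t := by
  obtain ⟨s, hs, hmin⟩ := isCompact_Icc.exists_isMinOn (nonempty_Icc.2 zero_le_one) (D.Fcont hb x)
  refine le_trans ?_ (hmin ht)
  by_contra! hneg
  have hs0 : 0 < s := by
    rcases hs.1.eq_or_lt with h | h
    · rw [← h, F0 hb] at hneg; linarith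
    · exact h
  have h1 := (D.op hb x ⟨hs0, hs.2⟩).2
  have h2 : ∫ u in Ioo (0:ℝ) 1, (ksF r b x s - ksF r b x (s * u)) * w u ≤ 0 := by
    refine setIntegral_nonpos measurableSet_Ioo (fun u hu => ?_)
    have : ksF r b x s ≤ ksF r b x (s * u) :=
      hmin ⟨by nlinarith [hu.1], by nlinarith [hu.1, hu.2, hs.2]⟩
    have := D.wpos u hu
    nlinarith
  rw [h1] at h2
  have h3 : 0 < s ^ b := Real.rpow_pos_of_pos hs0 _
  have h4 := D.kap
  have h5 : 0 < (x * ksF r b x s) * s ^ b := mul_pos (mul_pos_of_neg_of_neg hx hneg) h3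
  nlinarith [mul_nonneg h4 (show 0 ≤ 1 - ksF r b x s by linarith)]

lemma neg_case {w r : ℝ → ℝ} {κ : ℝ} (D : KSData w r κ) {b₁ b₂ : ℝ} (hb₁ : 0 < b₁) (hb : b₁ < b₂)
    {x : ℝ} (hx : x < 0) : ksF r b₁ x 1 < ksF r b₂ x 1 := by
  have hb₂ := hb₁.trans hb
  set H : ℝ → ℝ := fun t => ksF r b₂ x t - ksF r b₁ x t with hH
  have Hcont : ContinuousOn H (Icc 0 1) := (D.Fcont hb₂ x).sub (D.Fcont hb₁ x)
  have H0 : H 0 = 0 := by simp [hH, F0 hb₁, F0 hb₂]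
  have Hint : ∀ t ∈ Ioc (0:ℝ) 1, IntegrableOn (fun u => (H t - H (t * u)) * w u) (Ioo 0 1) := by
    intro t ht
    refine ((D.op hb₂ x ht).1.sub (D.op hb₁ x ht).1).congr (ae_of_all _ fun u => ?_)
    simp only [hH, Pi.sub_apply]; ring
  have Hop : ∀ t ∈ Ioc (0:ℝ) 1, ∫ u in Ioo (0:ℝ) 1, (H t - H (t * u)) * w u
      = -κ * H t + x * t ^ b₂ * H t + (-x) * (t ^ b₁ - t ^ b₂) * ksF r b₁ x t := by
    intro t ht
    have h := integral_sub (D.op hb₂ x ht).1 (D.op hb₁ x ht).1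
    rw [(D.op hb₂ x ht).2, (D.op hb₁ x ht).2] at h
    rw [show -κ * H t + x * t ^ b₂ * H t + (-x) * (t ^ b₁ - t ^ b₂) * ksF r b₁ x t =
      κ * (1 - ksF r b₂ x t) + x * t ^ b₂ * ksF r b₂ x t
       - (κ * (1 - ksF r b₁ x t) + x * t ^ b₁ * ksF r b₁ x t) by simp only [hH]; ring, ← h]
    refine integral_congr_ae (ae_of_all _ fun u => ?_)
    simp only [hH]; ring
  have Hnn : ∀ t ∈ Icc (0:ℝ) 1, 0 ≤ H t := by
    intro t ht
    obtain ⟨s, hs, hmin⟩ := isCompact_Icc.exists_isMinOn (nonempty_Icc.2 zero_le_one) Hcont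
    refine le_trans ?_ (hmin ht)
    by_contra! hneg
    have hs0 : 0 < s := by
      rcases hs.1.eq_or_lt with h | h
      · rw [← h, H0] at hneg; linarith
      · exact h
    have h1 := Hop s ⟨hs0, hs.2⟩
    have h2 : ∫ u in Ioo (0:ℝ) 1, (H s - H (s * u)) * w u ≤ 0 := by
      refine setIntegral_nonpos measurableSet_Ioo (fun u hu => ?_)
      have : H s ≤ H (s * u) :=
        hmin ⟨by nlinarith [hu.1], by nlinarith [hu.1, hu.2, hs.2]⟩
      have := D.wpos u hu
      nlinarith
    rw [h1] at h2
    have h3 : 0 < s ^ b₂ := Real.rpow_pos_of_pos hs0 _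
    have h4 := D.kap
    have h5 : 0 < (x * H s) * s ^ b₂ := mul_pos (mul_pos_of_neg_of_neg hx hneg) h3
    have h6 : s ^ b₂ ≤ s ^ b₁ := Real.rpow_le_rpow_of_exponent_ge hs0 hs.2 hb.le
    have h7 : 0 ≤ (-x) * (s ^ b₁ - s ^ b₂) * ksF r b₁ x s :=
      mul_nonneg (mul_nonneg (by linarith) (by linarith)) (D.Fnonneg hb₁ hx hs)
    nlinarith [mul_nonneg h4 (show 0 ≤ - H s by linarith)]
  by_contra! hcon
  have H1 : H 1 = 0 := le_antisymm (by simp only [hH]; linarith) (Hnn 1 (by simp))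
  have h1 := Hop 1 (by simp)
  have hi := (Hint 1 (by simp)).neg
  simp only [H1, one_mul, Real.one_rpow, sub_self, mul_zero, zero_mul, add_zero, zero_sub] at h1
  have h2 : ∫ u in Ioo (0:ℝ) 1, H u * w u = 0 := by
    rw [← neg_eq_zero, ← integral_neg]
    refine Eq.trans (integral_congr_ae (ae_of_all _ fun u => ?_)) h1
    ring
  have hi' : IntegrableOn (fun u => H u * w u) (Ioo 0 1) := by
    refine hi.congr (ae_of_all _ fun u => ?_)
    simp [H1]
  have h3 : H =ᵐ[volume.restrict (Ioo 0 1)] (fun _ => 0) := by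
    rw [setIntegral_eq_zero_iff_of_nonneg_ae _ hi'] at h2
    · filter_upwards [h2, ae_restrict_mem measurableSet_Ioo] with u hu hm
      rcases mul_eq_zero.1 hu with h | h
      · exact h
      · exact absurd h (D.wpos u hm).ne'
    · filter_upwards [ae_restrict_mem measurableSet_Ioo] with u hm
      exact mul_nonneg (Hnn u ⟨hm.1.le, hm.2.le⟩) (D.wpos u hm).le
  have h4 : EqOn H (fun _ => 0) (Ioo 0 1) :=
    Measure.eqOn_open_of_ae_eq h3 isOpen_Ioo (Hcont.mono Ioo_subset_Icc_self) continuousOn_const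
  have h5 : ∀ t ∈ Ioo (0:ℝ) 1, ksF r b₁ x t = 0 := by
    intro t ht
    have h6 := Hop t ⟨ht.1, ht.2.le⟩
    have h7 : ∫ u in Ioo (0:ℝ) 1, (H t - H (t * u)) * w u = 0 := by
      refine setIntegral_eq_zero_of_forall_eq_zero fun u hu => ?_
      have e1 : H t = 0 := h4 ht
      have e2 : H (t * u) = 0 := h4 ⟨mul_pos ht.1 hu.1, by nlinarith [ht.1, ht.2, hu.2]⟩
      simp [e1, e2]
    have e1 : H t = 0 := h4 ht
    rw [h7, e1] at h6
    have h8 := Real.rpow_lt_rpow_of_exponent_gt ht.1 ht.2 hb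
    have h9 : (-x) * (t ^ b₁ - t ^ b₂) * ksF r b₁ x t = 0 := by linarith
    have h10 : (-x) * (t ^ b₁ - t ^ b₂) ≠ 0 := mul_ne_zero (by linarith) (by linarith)
    exact (mul_eq_zero.1 h9).resolve_left h10
  have h6 : EqOn (ksF r b₁ x) (fun _ => 0) (Icc 0 1) := by
    refine EqOn.of_subset_closure (s := Ioo 0 1) h5 (D.Fcont hb₁ x) continuousOn_const
      Ioo_subset_Icc_self ?_
    rw [closure_Ioo (by norm_num)]
  have := h6 (show (0:ℝ) ∈ Icc (0:ℝ) 1 by simp)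
  rw [F0 hb₁] at this
  norm_num at this

lemma pos_case {w r : ℝ → ℝ} {κ : ℝ} (D : KSData w r κ) {b₁ b₂ : ℝ} (hb₁ : 0 < b₁) (hb : b₁ < b₂)
    {x : ℝ} (hx : 0 < x) : ksF r b₂ x 1 < ksF r b₁ x 1 := by
  have hb₂ := hb₁.trans hb
  have key : ∀ k : ℕ, 1 / r (b₂ * (k + 1)) < 1 / r (b₁ * (k + 1)) := fun k =>
    one_div_lt_one_div_of_lt (D.rpos' (by positivity))
      (D.rmono (by positivity) (mul_lt_mul_of_pos_right hb (by positivity)))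
  have kpos : ∀ k : ℕ, 0 < 1 / r (b₂ * (k + 1)) := fun k =>
    one_div_pos.2 (D.rpos' (by positivity))
  unfold ksF
  refine Summable.tsum_lt_tsum (i := 1) (fun n => ?_) ?_ (D.Fsum hb₂ x (by simp))
    (D.Fsum hb₁ x (by simp))
  · simp only [Real.one_rpow, mul_one, ksC]
    refine mul_le_mul_of_nonneg_right ?_ (by positivity)
    exact Finset.prod_le_prod (fun k _ => (kpos k).le) (fun k _ => (key k).le)
  · simp only [Real.one_rpow, mul_one, ksC]
    refine mul_lt_mul_of_pos_right ?_ (by positivity)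
    simpa using key 0

end KSData

lemma beta_facts {a b : ℝ} (ha : 0 < a) (hb : 0 < b) :
    IntegrableOn (fun u : ℝ => u ^ (a - 1) * (1 - u) ^ (b - 1)) (Ioo 0 1) ∧
    ∫ u in Ioo (0:ℝ) 1, u ^ (a - 1) * (1 - u) ^ (b - 1)
      = Real.Gamma a * Real.Gamma b / Real.Gamma (a + b) := by
  have h0 := ProbabilityTheory.lintegral_betaPDF_eq_one ha hb
  have hbp := ProbabilityTheory.beta_pos ha hb
  have hnn : 0 ≤ᵐ[volume.restrict (Ioo (0:ℝ) 1)] fun u : ℝ =>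
      1 / ProbabilityTheory.beta a b * u ^ (a - 1) * (1 - u) ^ (b - 1) := by
    filter_upwards [ae_restrict_mem measurableSet_Ioo] with u hu
    have h1 := hu.1
    have h2 : 0 < 1 - u := by linarith [hu.2]
    simp only [Pi.zero_apply]
    positivity
  have hm : AEStronglyMeasurable (fun u : ℝ =>
      1 / ProbabilityTheory.beta a b * u ^ (a - 1) * (1 - u) ^ (b - 1))
      (volume.restrict (Ioo (0:ℝ) 1)) := Measurable.aestronglyMeasurable (by fun_prop)
  rw [ProbabilityTheory.lintegral_betaPDF] at h0
  have hI : ∫ u in Ioo (0:ℝ) 1, 1 / ProbabilityTheory.beta a b * u ^ (a - 1) * (1 - u) ^ (b - 1)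
      = 1 := by
    rw [integral_eq_lintegral_of_nonneg_ae hnn hm, h0]; simp
  have hint := Integrable.of_integral_ne_zero (hI.trans_ne one_ne_zero)
  constructor
  · refine (hint.const_mul (ProbabilityTheory.beta a b)).congr (ae_of_all _ fun u => ?_)
    beta_reduce
    field_simp
  · simp_rw [mul_assoc, integral_const_mul] at hI
    rw [← ProbabilityTheory.beta]
    field_simp at hI
    exact hI

lemma one_sub_rpow_le {u p : ℝ} (hu : u ∈ Ioo (0:ℝ) 1) (hp : 0 < p) :
    1 - u ^ p ≤ (1 + p) * (1 - u) := by
  rcases le_total p 1 with h | h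
  · have := Real.rpow_le_rpow_of_exponent_ge hu.1 hu.2.le h
    rw [Real.rpow_one] at this
    nlinarith [hu.2]
  · have := one_add_mul_self_le_rpow_one_add (s := u - 1) (by linarith [hu.1]) h
    rw [add_sub_cancel] at this
    nlinarith [hu.2]

lemma ks_int {α a p : ℝ} (hα : α ∈ Ioo (0:ℝ) 1) (ha : 0 < a) (hp : 0 < p) :
    IntegrableOn (fun u : ℝ => (1 - u ^ p) * (u ^ (a - 1) * (1 - u) ^ (-1 - α))) (Ioo 0 1) := by
  have h := (beta_facts ha (b := 1 - α) (by linarith [hα.2])).1.const_mul (1 + p)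
  refine Integrable.mono' h (Measurable.aestronglyMeasurable (by fun_prop)) ?_
  filter_upwards [ae_restrict_mem measurableSet_Ioo] with u hu
  have h1 := hu.1
  have h2 : 0 < 1 - u := by linarith [hu.2]
  have h3 := (Real.rpow_lt_one hu.1.le hu.2 hp)
  have h4 : 0 < u ^ (a - 1) * (1 - u) ^ (-1 - α) := by positivity
  have h5 := one_sub_rpow_le hu hp
  rw [Real.norm_of_nonneg (mul_nonneg (by linarith) h4.le)]
  have e : (1 - u) ^ (1 - α - 1) = (1 - u) * (1 - u) ^ (-1 - α) := by
    rw [← Real.rpow_one_add' h2.le (by linarith [hα.1])]; ring_nf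
  rw [e]
  calc _ ≤ ((1 + p) * (1 - u)) * (u ^ (a - 1) * (1 - u) ^ (-1 - α)) :=
        mul_le_mul_of_nonneg_right h5 h4.le
    _ = _ := by ring

lemma tendsto_one_aux {α p : ℝ} (hα : α ∈ Ioo (0:ℝ) 1) (hp : 0 < p) :
    Tendsto (fun u : ℝ => (1 - u ^ p) * (1 - u) ^ (-α)) (𝓝[<] 1) (𝓝 0) := by
  have hev : ∀ᶠ u : ℝ in 𝓝[<] 1, u ∈ Ioo (0:ℝ) 1 := Ioo_mem_nhdsLT (by norm_num)
  have hlim : Tendsto (fun u : ℝ => (1 + p) * (1 - u) ^ (1 - α)) (𝓝[<] 1) (𝓝 0) := by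
    have : Continuous (fun u : ℝ => (1 + p) * (1 - u) ^ (1 - α)) :=
      continuous_const.mul ((Real.continuous_rpow_const (by linarith [hα.2])).comp (by fun_prop))
    have h := (this.tendsto 1).mono_left (nhdsWithin_le_nhds (s := Iio 1))
    simpa [Real.zero_rpow (show 1 - α ≠ 0 by linarith [hα.2])] using h
  refine squeeze_zero' ?_ ?_ hlim
  · filter_upwards [hev] with u hu
    have h2 : 0 < 1 - u := by linarith [hu.2]
    have h3 := (Real.rpow_lt_one hu.1.le hu.2 hp)
    exact mul_nonneg (by linarith) (by positivity)
  · filter_upwards [hev] with u hu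
    have h2 : 0 < 1 - u := by linarith [hu.2]
    rw [sub_eq_add_neg 1 α, Real.rpow_add h2, Real.rpow_one, ← mul_assoc]
    exact mul_le_mul_of_nonneg_right (one_sub_rpow_le hu hp) (by positivity)

lemma deriv_aux {α p u : ℝ} (hu : u ∈ Ioo (0:ℝ) 1) :
    HasDerivAt (fun u : ℝ => (1 - u ^ p) * (1 - u) ^ (-α))
      (α * ((1 - u ^ p) * (1 - u) ^ (-1 - α)) - p * (u ^ (p - 1) * (1 - u) ^ (-α))) u := by
  have h2 : 0 < 1 - u := by linarith [hu.2]
  have d1 := ((Real.hasDerivAt_rpow_const (x := u) (p := p) (Or.inl hu.1.ne')).const_sub 1)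
  have d2 := (((hasDerivAt_id u).const_sub 1).rpow_const (p := -α) (Or.inl h2.ne'))
  refine (d1.mul d2).congr_deriv ?_
  simp only [id]
  rw [show -α - 1 = -1 - α by ring]
  ring

lemma int_case1 {α p : ℝ} (hα : α ∈ Ioo (0:ℝ) 1) (hp : 0 < p) :
    α * ∫ u in Ioo (0:ℝ) 1, (1 - u ^ p) * (1 - u) ^ (-1 - α)
      = p * (Real.Gamma p * Real.Gamma (1 - α) / Real.Gamma (p + (1 - α))) - 1 := by
  have hb := beta_facts hp (b := 1 - α) (by linarith [hα.2])
  have e1 : (1 - α - 1) = -α := by ring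
  rw [e1] at hb
  have i1 : IntegrableOn (fun u : ℝ => (1 - u ^ p) * (1 - u) ^ (-1 - α)) (Ioo 0 1) := by
    simpa using ks_int hα one_pos hp
  have i1' := i1.const_mul α
  have i2' := hb.1.const_mul p
  have hft := intervalIntegral.integral_eq_sub_of_hasDerivAt_of_tendsto (a := 0) (b := 1)
    (f := fun u : ℝ => (1 - u ^ p) * (1 - u) ^ (-α)) (fa := 1) (fb := 0) one_pos
    (fun u hu => deriv_aux hu)
    (by rw [intervalIntegrable_iff_integrableOn_Ioo_of_le zero_le_one]; exact i1'.sub i2')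
    (by
      have : ContinuousAt (fun u : ℝ => (1 - u ^ p) * (1 - u) ^ (-α)) 0 := by
        refine ContinuousAt.mul (continuousAt_const.sub
          (Real.continuous_rpow_const hp.le).continuousAt) ?_
        exact ContinuousAt.rpow_const (by fun_prop) (Or.inl (by norm_num))
      have h := this.tendsto.mono_left (nhdsWithin_le_nhds (s := Ioi 0))
      simpa [Real.zero_rpow hp.ne'] using h)
    (tendsto_one_aux hα hp)
  rw [intervalIntegral.integral_of_le zero_le_one, integral_Ioc_eq_integral_Ioo,
    integral_sub i1' i2', integral_const_mul, integral_const_mul, hb.2] at hft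
  linarith

lemma int_case2 {α p : ℝ} (hα : α ∈ Ioo (0:ℝ) 1) (hp : 0 < p) :
    α * ∫ u in Ioo (0:ℝ) 1, (1 - u ^ p) * (u ^ (α - 1) * (1 - u) ^ (-1 - α))
      = p * (Real.Gamma (p + α) * Real.Gamma (1 - α) / Real.Gamma (p + α + (1 - α))) := by
  have hb := beta_facts (a := p + α) (by linarith [hα.1]) (b := 1 - α) (by linarith [hα.2])
  have e1 : (1 - α - 1) = -α := by ring
  rw [e1] at hb
  have i1 := ks_int hα hα.1 hp
  have i1' := i1.const_mul α
  have i2' := hb.1.const_mul p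
  have hft := intervalIntegral.integral_eq_sub_of_hasDerivAt_of_tendsto (a := 0) (b := 1)
    (f := fun u : ℝ => u ^ α * ((1 - u ^ p) * (1 - u) ^ (-α))) (fa := 0) (fb := 0) one_pos
    (f' := fun u : ℝ => α * ((1 - u ^ p) * (u ^ (α - 1) * (1 - u) ^ (-1 - α)))
      - p * (u ^ (p + α - 1) * (1 - u) ^ (-α)))
    (fun u hu => by
      have h1 := hu.1
      have h2 : 0 < 1 - u := by linarith [hu.2]
      have d1 := Real.hasDerivAt_rpow_const (x := u) (p := α) (Or.inl hu.1.ne')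
      refine (d1.mul (deriv_aux (α := α) (p := p) hu)).congr_deriv ?_
      have e2 : u ^ (p + α - 1) = u ^ α * u ^ (p - 1) := by
        rw [← Real.rpow_add h1]; ring_nf
      have e3 : u ^ α = u * u ^ (α - 1) := by
        rw [← Real.rpow_one_add' h1.le (by linarith [hα.1])]; ring_nf
      have e4 : (1 - u) ^ (-α) = (1 - u) * (1 - u) ^ (-1 - α) := by
        rw [← Real.rpow_one_add' h2.le (by linarith [hα.1])]; ring_nf
      rw [e2, e3, e4]; ring)
    (by rw [intervalIntegrable_iff_integrableOn_Ioo_of_le zero_le_one]; exact i1'.sub i2')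
    (by
      have : ContinuousAt (fun u : ℝ => u ^ α * ((1 - u ^ p) * (1 - u) ^ (-α))) 0 := by
        refine ContinuousAt.mul (Real.continuous_rpow_const hα.1.le).continuousAt
          (ContinuousAt.mul (continuousAt_const.sub
          (Real.continuous_rpow_const hp.le).continuousAt) ?_)
        exact ContinuousAt.rpow_const (by fun_prop) (Or.inl (by norm_num))
      have h := this.tendsto.mono_left (nhdsWithin_le_nhds (s := Ioi 0))
      simpa [Real.zero_rpow hp.ne', Real.zero_rpow hα.1.ne'] using h)
    (by
      have h := ((Real.continuous_rpow_const hα.1.le).tendsto 1).mono_left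
        (nhdsWithin_le_nhds (s := Iio 1))
      simpa using h.mul (tendsto_one_aux hα hp))
  rw [intervalIntegral.integral_of_le zero_le_one, integral_Ioc_eq_integral_Ioo,
    integral_sub i1' i2', integral_const_mul, integral_const_mul, hb.2] at hft
  linarith

lemma gamma_top {α : ℝ} (hα : α ∈ Ioo (0:ℝ) 1) :
    Tendsto (fun q : ℝ => Real.Gamma (q + α) / Real.Gamma q) atTop atTop := by
  have hlim : Tendsto (fun q : ℝ => (1/2) * (2 * q) ^ α) atTop atTop :=
    Tendsto.const_mul_atTop (by norm_num)
      ((tendsto_rpow_atTop hα.1).comp (Tendsto.const_mul_atTop (by norm_num) tendsto_id))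
  refine tendsto_atTop_mono' _ ?_ hlim
  filter_upwards [eventually_ge_atTop 1] with q hq
  have hq0 : 0 < q := by linarith
  have hα0 := hα.1
  have hα1 := hα.2
  have g1 := Real.Gamma_pos_of_pos hq0
  have g2 := Real.Gamma_pos_of_pos (show 0 < q + α by linarith)
  have h := Real.Gamma_mul_add_mul_le_rpow_Gamma_mul_rpow_Gamma (s := q + α) (t := q + α + 1)
    (a := α) (b := 1 - α) (by linarith) (by linarith) hα0 (by linarith) (by ring)
  rw [show α * (q + α) + (1 - α) * (q + α + 1) = q + 1 by ring,
    Real.Gamma_add_one hq0.ne', Real.Gamma_add_one (show q + α ≠ 0 by linarith),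
    Real.mul_rpow (by linarith) g2.le, mul_left_comm, ← Real.rpow_add g2, add_sub_cancel,
    Real.rpow_one] at h
  have h1 : (q + α) ^ (1 - α) ≤ (2 * q) ^ (1 - α) :=
    Real.rpow_le_rpow (by linarith) (by linarith) (by linarith)
  have h2 : q * Real.Gamma q ≤ (2 * q) ^ (1 - α) * Real.Gamma (q + α) :=
    h.trans (mul_le_mul_of_nonneg_right h1 g2.le)
  have h3 : (2 * q) ^ α * (2 * q) ^ (1 - α) = 2 * q := by
    rw [← Real.rpow_add (by linarith), add_sub_cancel, Real.rpow_one]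
  have h4 : 0 < (2 * q) ^ (1 - α) := by positivity
  rw [le_div_iff₀ g1]
  refine le_of_mul_le_mul_left ?_ h4
  calc _ = (1/2) * ((2 * q) ^ α * (2 * q) ^ (1 - α)) * Real.Gamma q := by ring
    _ = q * Real.Gamma q := by rw [h3]; ring
    _ ≤ _ := h2

lemma ksData1 {α : ℝ} (hα : α ∈ Ioo (0:ℝ) 1) :
    KSData (fun u => α / Real.Gamma (1 - α) * (1 - u) ^ (-1 - α))
      (fun p => Real.Gamma (p + 1) / Real.Gamma (p + 1 - α)) (1 / Real.Gamma (1 - α)) := by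
  have hα0 := hα.1
  have hα1 := hα.2
  have g := Real.Gamma_pos_of_pos (show 0 < 1 - α by linarith)
  have e : ∀ p : ℝ, (fun u : ℝ => (1 - u ^ p) * (α / Real.Gamma (1 - α) * (1 - u) ^ (-1 - α)))
      = fun u => α / Real.Gamma (1 - α) * ((1 - u ^ p) * (1 - u) ^ (-1 - α)) := by
    intro p; ext u; ring
  refine ⟨?_, ?_, by positivity, ?_, ?_, ?_⟩
  · intro u hu
    have : 0 < 1 - u := by linarith [hu.2]
    positivity
  · refine continuousOn_const.mul (ContinuousOn.rpow_const (by fun_prop) ?_)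
    intro u hu
    exact Or.inl (by linarith [hu.2])
  · intro p hp
    rw [e]
    refine Integrable.const_mul ?_ _
    simpa [IntegrableOn] using ks_int hα one_pos hp
  · intro p hp
    simp only [e]
    have g' := Real.Gamma_pos_of_pos (show 0 < p + 1 - α by linarith)
    rw [integral_const_mul, div_mul_eq_mul_div, int_case1 hα hp, Real.Gamma_add_one hp.ne',
      ← add_sub_assoc]
    field_simp
    ring
  · have := (gamma_top hα).comp (tendsto_atTop_add_const_right _ (1 - α) tendsto_id)
    refine this.congr fun p => ?_
    simp only [Function.comp, id]
    ring_nf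

lemma ksData2 {α : ℝ} (hα : α ∈ Ioo (0:ℝ) 1) :
    KSData (fun u => α / Real.Gamma (1 - α) * (u ^ (α - 1) * (1 - u) ^ (-1 - α)))
      (fun p => Real.Gamma (p + α) / Real.Gamma p) 0 := by
  have hα0 := hα.1
  have hα1 := hα.2
  have g := Real.Gamma_pos_of_pos (show 0 < 1 - α by linarith)
  have e : ∀ p : ℝ, (fun u : ℝ => (1 - u ^ p) *
      (α / Real.Gamma (1 - α) * (u ^ (α - 1) * (1 - u) ^ (-1 - α))))
      = fun u => α / Real.Gamma (1 - α) * ((1 - u ^ p) * (u ^ (α - 1) * (1 - u) ^ (-1 - α))) := by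
    intro p; ext u; ring
  refine ⟨?_, ?_, le_rfl, ?_, ?_, gamma_top hα⟩
  · intro u hu
    have := hu.1
    have : 0 < 1 - u := by linarith [hu.2]
    positivity
  · refine continuousOn_const.mul (ContinuousOn.mul (ContinuousOn.rpow_const (by fun_prop) ?_)
      (ContinuousOn.rpow_const (by fun_prop) ?_))
    · intro u hu
      exact Or.inl hu.1.ne'
    · intro u hu
      exact Or.inl (by linarith [hu.2])
  · intro p hp
    rw [e]
    exact Integrable.const_mul (ks_int hα hα0 hp) _
  · intro p hp
    simp only [e]
    have g' := Real.Gamma_pos_of_pos hp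
    rw [integral_const_mul, div_mul_eq_mul_div, int_case2 hα hp,
      show p + α + (1 - α) = p + 1 by ring, Real.Gamma_add_one hp.ne']
    field_simp
    ring

lemma ks_eq1 (α m x : ℝ) : kilbasSaigo α m (m - 1) x
    = ksF (fun p => Real.Gamma (p + 1) / Real.Gamma (p + 1 - α)) (α * m) x 1 := by
  unfold kilbasSaigo ksF ksC
  refine tsum_congr fun n => ?_
  rw [Real.one_rpow, mul_one]
  congr 1
  refine Finset.prod_congr rfl fun k _ => ?_
  rw [one_div_div]
  congr 2 <;> ring

lemma ks_eq2 {α : ℝ} (hα : α ≠ 0) (m x : ℝ) : kilbasSaigo α m (m - 1 / α) x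
    = ksF (fun p => Real.Gamma (p + α) / Real.Gamma p) (α * m) x 1 := by
  unfold kilbasSaigo ksF ksC
  refine tsum_congr fun n => ?_
  rw [Real.one_rpow, mul_one]
  congr 1
  refine Finset.prod_congr rfl fun k _ => ?_
  rw [one_div_div]
  congr 2 <;> field_simp <;> ring

lemma ks_one {m : ℝ} (hm : 0 < m) (x : ℝ) : kilbasSaigo 1 m (m - 1) x = Real.exp (x / m) := by
  unfold kilbasSaigo
  rw [Real.exp_eq_exp_ℝ, NormedSpace.exp_eq_tsum_div]
  refine tsum_congr fun n => ?_
  have : ∏ k ∈ Finset.range n, Real.Gamma (1 + 1 * (k * m + (m - 1))) /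
      Real.Gamma (1 + 1 * (k * m + (m - 1) + 1)) = 1 / (m ^ n * n.factorial) := by
    induction n with
    | zero => simp
    | succ n ih =>
      rw [Finset.prod_range_succ, ih, Nat.factorial_succ]
      have h : 0 < m * (n + 1) := by positivity
      rw [show 1 + 1 * ((n:ℝ) * m + (m - 1)) = m * (n + 1) by ring,
        show 1 + 1 * ((n:ℝ) * m + (m - 1) + 1) = m * (n + 1) + 1 by ring, Real.Gamma_add_one h.ne']
      have g := Real.Gamma_pos_of_pos h
      push_cast
      field_simp
      ring
  rw [this, div_pow]
  field_simp

theorem kilbasSaigo_strict_mono_in_m (α x m₁ m₂ : ℝ)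
    (hα : α ∈ Set.Ioc (0 : ℝ) 1) (hx : x ≠ 0) (hm₁ : 0 < m₁) (hm : m₁ < m₂) :
    (0 < x →
      kilbasSaigo α m₂ (m₂ - 1) x < kilbasSaigo α m₁ (m₁ - 1) x ∧
      kilbasSaigo α m₂ (m₂ - 1 / α) x < kilbasSaigo α m₁ (m₁ - 1 / α) x) ∧
    (x < 0 →
      kilbasSaigo α m₁ (m₁ - 1) x < kilbasSaigo α m₂ (m₂ - 1) x ∧
      kilbasSaigo α m₁ (m₁ - 1 / α) x < kilbasSaigo α m₂ (m₂ - 1 / α) x) := by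
  rcases hα.2.eq_or_lt with h1 | h1
  · subst h1
    have hm₂ := hm₁.trans hm
    rw [div_one, ks_one hm₁, ks_one hm₂]
    simp only [and_self, Real.exp_lt_exp]
    refine ⟨fun h => div_lt_div_of_pos_left h hm₁ hm, fun h => ?_⟩
    have := div_lt_div_of_pos_left (neg_pos.2 h) hm₁ hm
    rw [neg_div, neg_div] at this
    linarith
  · have hα' : α ∈ Ioo (0:ℝ) 1 := ⟨hα.1, h1⟩
    have hb₁ : 0 < α * m₁ := mul_pos hα.1 hm₁
    have hb : α * m₁ < α * m₂ := mul_lt_mul_of_pos_left hm hα.1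
    rw [ks_eq1, ks_eq1, ks_eq2 hα.1.ne', ks_eq2 hα.1.ne']
    exact ⟨fun h => ⟨(ksData1 hα').pos_case hb₁ hb h, (ksData2 hα').pos_case hb₁ hb h⟩,
      fun h => ⟨(ksData1 hα').neg_case hb₁ hb h, (ksData2 hα').neg_case hb₁ hb h⟩⟩
end
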